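/- For every map φ : [0,∞) → [0,∞) satisfying φ(t) = o(t^{1/3}) as t → ∞, and for every nonempty open subset 𝒱 of ℝ, the set of irrational numbers θ ∈ 𝒱 such that the irrational rotation R_θ is φ-integrably orbit equivalent to the universal odometer is uncountable. -/

import Mathlib

/-- A measure-theoretic dynamical system: an invertible bimeasurable transformation
of a measure space. -/
structure MSystem where
  carrier : Type
  [meas : MeasurableSpace carrier]
  μ : MeasureTheory.Measure carrier
  T : carrier ≃ᵐ carrier

attribute [instance] MSystem.meas

open MeasureTheory Filter Set Topology

/-- A cutting and spacing parameter: an integer `q ≥ 2` (the cutting parameter) together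
with nonnegative integers `σ 0, …, σ q` (the spacing parameters), represented as a
function `ℕ → ℕ` vanishing above `q`. -/
structure CSParam where
  q : ℕ
  two_le_q : 2 ≤ q
  σ : ℕ → ℕ
  σ_eq_zero_of_gt : ∀ i, q < i → σ i = 0

/-- The total number `σ_n = σ_{n,0} + ⋯ + σ_{n,q_n}` of spacers added at one step. -/
def CSParam.σtot (P : CSParam) : ℕ := ∑ i ∈ Finset.range (P.q + 1), P.σ i

/-- The height sequence associated with a sequence of cutting and spacing parameters:
`h 0 = 1` and `h (n+1) = q_n · h_n + σ_n`. -/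
def heights (p : ℕ → CSParam) : ℕ → ℕ
  | 0 => 1
  | n + 1 => (p n).q * heights p n + (p n).σtot

/-- `Z_n`, the maximum spacing parameter over the first `n+1` steps. -/
def Zmax (p : ℕ → CSParam) (n : ℕ) : ℕ :=
  (Finset.range (n + 1)).sup fun j => (Finset.range ((p j).q + 1)).sup (p j).σ

/-- Condition (F): the series `Σ σ_n / h_{n+1}` converges. -/
def CondF (p : ℕ → CSParam) : Prop :=
  Summable fun n => ((p n).σtot : ℝ) / (heights p (n + 1) : ℝ)

/-- The level of the `(n+1)`-th tower at which the `i`-th subcolumn of the `n`-th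
tower starts, namely `σ_{n,0} + ⋯ + σ_{n,i} + i·h_n`. -/
def colStart (p : ℕ → CSParam) (n i : ℕ) : ℕ :=
  (∑ j ∈ Finset.range (i + 1), (p n).σ j) + i * heights p n

/-- The subset `X_n` covered by the `n`-th tower. -/
def towerUnion {X : Type} [MeasurableSpace X] (T : X ≃ᵐ X) (p : ℕ → CSParam)
    (B : ℕ → Set X) (n : ℕ) : Set X :=
  ⋃ k ∈ Finset.range (heights p n), (⇑T)^[k] '' B n

/-- A cutting-and-stacking tower structure for `T`, with parameters `p`, bases `B n`
(so that the `n`-th tower has levels `T^k (B n)`, `k < h_n`), and subdivision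
`Bsub n 0, …, Bsub n (q_n - 1)` of `B n`: the `(n+1)`-th tower is obtained by stacking,
in order, `σ_{n,0}` spacer levels, the subcolumn over `Bsub n 0`, `σ_{n,1}` spacer levels,
…, the subcolumn over `Bsub n (q_n-1)`, and `σ_{n,q_n}` spacer levels on top, the spacer
levels being disjoint from `X_n`. -/
structure IsCuttingStacking {X : Type} [MeasurableSpace X] (T : X ≃ᵐ X)
    (p : ℕ → CSParam) (B : ℕ → Set X) (Bsub : ℕ → ℕ → Set X) : Prop where
  meas_base : ∀ n, MeasurableSet (B n)
  meas_sub : ∀ n, ∀ i < (p n).q, MeasurableSet (Bsub n i)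
  disj_levels : ∀ n, ∀ k < heights p n, ∀ l < heights p n, k ≠ l →
    Disjoint ((⇑T)^[k] '' B n) ((⇑T)^[l] '' B n)
  disj_sub : ∀ n, ∀ i < (p n).q, ∀ j < (p n).q, i ≠ j → Disjoint (Bsub n i) (Bsub n j)
  union_sub : ∀ n, B n = ⋃ i ∈ Finset.range (p n).q, Bsub n i
  subcolumn : ∀ n, ∀ i < (p n).q, ∀ k < heights p n,
    (⇑T)^[colStart p n i + k] '' B (n + 1) = (⇑T)^[k] '' Bsub n i
  spacer_disjoint : ∀ n, ∀ l < heights p (n + 1),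
    (∀ i < (p n).q, ∀ k < heights p n, l ≠ colStart p n i + k) →
    Disjoint ((⇑T)^[l] '' B (n + 1)) (towerUnion T p B n)

/-- The towers with bases `B n` increase to the full σ-algebra modulo `μ`-null sets. -/
def TowersGenerate {X : Type} [MeasurableSpace X] (μ : Measure X) (T : X ≃ᵐ X)
    (p : ℕ → CSParam) (B : ℕ → Set X) : Prop :=
  ∀ A : Set X, MeasurableSet A → ∃ A' : Set X,
    MeasurableSet[MeasurableSpace.generateFrom
      {s : Set X | ∃ n k, k < heights p n ∧ s = (⇑T)^[k] '' B n}] A' ∧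
    μ (symmDiff A A') = 0

/-- `T` is a rank-one system with cutting and spacing parameters `p` on `(X, μ)`. -/
def IsRankOneWith {X : Type} [MeasurableSpace X] (μ : Measure X) (T : X ≃ᵐ X)
    (p : ℕ → CSParam) : Prop :=
  MeasurePreserving T μ μ ∧ CondF p ∧
    ∃ B Bsub, IsCuttingStacking T p B Bsub ∧ TowersGenerate μ T p B

/-- `T` is a rank-one system on `(X, μ)`. -/
def IsRankOne {X : Type} [MeasurableSpace X] (μ : Measure X) (T : X ≃ᵐ X) : Prop :=
  ∃ p, IsRankOneWith μ T p

/-- Iterates, indexed by `ℤ`, of a measurable equivalence. -/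
def zIter {X : Type} [MeasurableSpace X] (T : X ≃ᵐ X) (n : ℤ) (x : X) : X :=
  if 0 ≤ n then (⇑T)^[n.toNat] x else (⇑T.symm)^[(-n).toNat] x

/-- The `T`-orbit of a point. -/
def orbit {X : Type} [MeasurableSpace X] (T : X ≃ᵐ X) (x : X) : Set X :=
  Set.range fun n : ℤ => zIter T n x

/-- `S` is the universal odometer: a rank-one system admitting a construction with no
spacers whose cutting parameters `q'_n` are such that every positive integer divides
some product `q'_0 ⋯ q'_{n-1}`. -/
def IsUniversalOdometer {X : Type} [MeasurableSpace X] (μ : Measure X) (S : X ≃ᵐ X) : Prop :=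
  ∃ p : ℕ → CSParam, IsRankOneWith μ S p ∧ (∀ n i, (p n).σ i = 0) ∧
    ∀ N : ℕ, 0 < N → ∃ n, N ∣ ∏ k ∈ Finset.range n, (p k).q

/-- `T` (acting on `(X,μ)`) and `S` (acting on `(Y,ν)`) are φ-integrably orbit
equivalent: there is a measure-preserving bimeasurable bijection matching a.e. `T`-orbit
with the corresponding `S`-orbit, whose cocycles `c_T`, `c_S` satisfy
`∫ φ(|c_T|) dμ < ∞` and `∫ φ(|c_S|) dν < ∞`. -/
def PhiIntegrablyOE {X Y : Type} [MeasurableSpace X] [MeasurableSpace Y]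
    (μ : Measure X) (T : X ≃ᵐ X) (ν : Measure Y) (S : Y ≃ᵐ Y) (φ : ℝ → ℝ) : Prop :=
  ∃ Ψ : X ≃ᵐ Y, MeasurePreserving Ψ μ ν ∧
    (∀ᵐ x ∂μ, Ψ '' orbit T x = orbit S (Ψ x)) ∧
    ∃ cT : X → ℤ, ∃ cS : Y → ℤ,
      Measurable cT ∧ Measurable cS ∧
      (∀ᵐ x ∂μ, Ψ (T x) = zIter S (cT x) (Ψ x)) ∧
      (∀ᵐ y ∂ν, Ψ.symm (S y) = zIter T (cS y) (Ψ.symm y)) ∧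
      Integrable (fun x => φ |(cT x : ℝ)|) μ ∧
      Integrable (fun y => φ |(cS y : ℝ)|) ν

/-- The underlying space is a standard atomless probability space. -/
def MSystem.Standard (𝒮 : MSystem) : Prop :=
  StandardBorelSpace 𝒮.carrier ∧ IsProbabilityMeasure 𝒮.μ ∧ NoAtoms 𝒮.μ

/-- `T` is φ-integrably orbit equivalent to the universal odometer. -/
def PhiOEToUnivOdometer {X : Type} [MeasurableSpace X] (μ : Measure X) (T : X ≃ᵐ X)
    (φ : ℝ → ℝ) : Prop :=
  ∃ 𝒮 : MSystem, 𝒮.Standard ∧ IsUniversalOdometer 𝒮.μ 𝒮.T ∧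
    PhiIntegrablyOE μ T 𝒮.μ 𝒮.T φ

/-- `φ(t) = o(t^{1/3})` as `t → ∞`. -/
def SmallOCbrt (φ : ℝ → ℝ) : Prop :=
  Tendsto (fun t : ℝ => φ t / t ^ ((1 : ℝ) / 3)) atTop (nhds 0)

/-- The rotation of angle `θ` on the circle `ℝ/ℤ` (equipped with its Haar probability
measure `volume`), as a measurable equivalence. -/
noncomputable def rot (θ : ℝ) : AddCircle (1 : ℝ) ≃ᵐ AddCircle (1 : ℝ) :=
  MeasurableEquiv.addLeft (θ : AddCircle (1 : ℝ))

/-! ### Integer iterates -/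

section Iterates

variable {X : Type} [MeasurableSpace X]

theorem zIter_eq_zpow (T : X ≃ᵐ X) (n : ℤ) (x : X) :
    zIter T n x = ((T.toEquiv : Equiv.Perm X) ^ n) x := by
  unfold zIter
  split_ifs with h
  · obtain ⟨k, rfl⟩ := Int.eq_ofNat_of_zero_le h
    rw [zpow_natCast, Equiv.Perm.iterate_eq_pow T.toEquiv k |>.symm]
    rfl
  · obtain ⟨k, hk⟩ := Int.eq_ofNat_of_zero_le (show 0 ≤ -n by omega)
    obtain rfl : n = -(k : ℤ) := by omega
    rw [zpow_neg, zpow_natCast, ← inv_pow, ← Equiv.Perm.iterate_eq_pow]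
    simp only [neg_neg, Int.toNat_natCast]
    rfl

theorem zIter_zero (T : X ≃ᵐ X) (x : X) : zIter T 0 x = x := by simp [zIter]

theorem zIter_one (T : X ≃ᵐ X) (x : X) : zIter T 1 x = T x := by simp [zIter]

theorem zIter_add (T : X ≃ᵐ X) (m n : ℤ) (x : X) :
    zIter T (m + n) x = zIter T m (zIter T n x) := by
  simp [zIter_eq_zpow, zpow_add]

theorem zIter_natCast (T : X ≃ᵐ X) (n : ℕ) (x : X) : zIter T n x = (⇑T)^[n] x := by
  simp [zIter]

theorem zIter_neg_zIter (T : X ≃ᵐ X) (n : ℤ) (x : X) : zIter T (-n) (zIter T n x) = x := by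
  rw [← zIter_add, neg_add_cancel, zIter_zero]

theorem zIter_zIter_neg (T : X ≃ᵐ X) (n : ℤ) (x : X) : zIter T n (zIter T (-n) x) = x := by
  rw [← zIter_add, add_neg_cancel, zIter_zero]

theorem measurable_zIter (T : X ≃ᵐ X) (n : ℤ) : Measurable (zIter T n) := by
  unfold zIter
  split_ifs
  · exact T.measurable.iterate _
  · exact T.symm.measurable.iterate _

theorem measurePreserving_zIter {μ : Measure X} {T : X ≃ᵐ X} (hT : MeasurePreserving T μ μ)
    (n : ℤ) : MeasurePreserving (zIter T n) μ μ := by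
  have : zIter T n = if 0 ≤ n then (⇑T)^[n.toNat] else (⇑T.symm)^[(-n).toNat] := by
    ext x; unfold zIter; split_ifs <;> rfl
  rw [this]
  split_ifs
  · exact hT.iterate _
  · exact (hT.symm T).iterate _

theorem measurable_zIter_comp (T : X ≃ᵐ X) {c : X → ℤ} (hc : Measurable c) :
    Measurable fun x => zIter T (c x) x :=
  (measurable_from_prod_countable_right (f := fun p : ℤ × X => zIter T p.1 p.2)
    fun n => measurable_zIter T n).comp (hc.prodMk measurable_id)

/-- A bimeasurable bijection acting piecewise by powers of a measure-preserving transformation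
is measure-preserving. -/
theorem measurePreserving_of_eq_zIter {μ : Measure X} {T : X ≃ᵐ X}
    (hT : MeasurePreserving T μ μ) (S : X ≃ᵐ X) {c : X → ℤ} (hc : Measurable c)
    (hS : ∀ x, S x = zIter T (c x) x) : MeasurePreserving S μ μ := by
  refine ⟨S.measurable, Measure.ext fun A hA => ?_⟩
  rw [Measure.map_apply S.measurable hA]
  have hpc : ∀ k : ℤ, MeasurableSet ({x | c x = k} ∩ S ⁻¹' A) := fun k =>
    (hc (measurableSet_singleton k)).inter (S.measurable hA)
  have h1 : S ⁻¹' A = ⋃ k : ℤ, {x | c x = k} ∩ S ⁻¹' A := by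
    ext x; simp
  have himg : ∀ k : ℤ, S '' ({x | c x = k} ∩ S ⁻¹' A)
      = zIter T (-k) ⁻¹' ({x | c x = k} ∩ S ⁻¹' A) := by
    intro k
    ext y
    constructor
    · rintro ⟨x, ⟨hx, hxA⟩, rfl⟩
      have hx' : c x = k := hx
      have : zIter T (-k) (S x) = x := by rw [hS, hx', zIter_neg_zIter]
      rw [mem_preimage, this]
      exact ⟨hx, hxA⟩
    · rintro hy
      refine ⟨_, hy, ?_⟩
      have hk : c (zIter T (-k) y) = k := hy.1
      rw [hS, hk, zIter_zIter_neg]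
  have h2 : A = ⋃ k : ℤ, S '' ({x | c x = k} ∩ S ⁻¹' A) := by
    rw [← image_iUnion, ← h1, image_preimage_eq _ S.surjective]
  have hd : Pairwise (Function.onFun Disjoint fun k : ℤ => {x | c x = k} ∩ S ⁻¹' A) := by
    intro k l hkl
    refine Set.disjoint_left.2 fun x hx hx' => hkl ?_
    exact (show c x = k from hx.1).symm.trans hx'.1
  conv_lhs => rw [h1]
  conv_rhs => rw [h2]
  rw [measure_iUnion hd hpc, measure_iUnion]
  · refine tsum_congr fun k => ?_
    rw [himg, (measurePreserving_zIter hT (-k)).measure_preimage (hpc k).nullMeasurableSet]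
  · intro k l hkl
    exact (disjoint_image_iff S.injective).2 (hd hkl)
  · intro k
    exact S.measurableSet_image.2 (hpc k)

theorem orbit_subset_of_step {T S : X ≃ᵐ X} {Ω : Set X} (hΩ : ∀ x ∈ Ω, ∀ k, zIter T k x ∈ Ω)
    (h : ∀ x ∈ Ω, ∃ k, T x = zIter S k x) {x : X} (hx : x ∈ Ω) : orbit T x ⊆ orbit S x := by
  rintro _ ⟨n, rfl⟩
  induction n using Int.induction_on with
  | zero => exact ⟨0, by simp [zIter_zero]⟩
  | succ n ih =>
    obtain ⟨k, hk⟩ := ih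
    obtain ⟨l, hl⟩ := h _ (hΩ x hx n)
    refine ⟨l + k, ?_⟩
    simp only at hk ⊢
    rw [add_comm (n : ℤ), zIter_add, hk, zIter_add T, zIter_one, hl]
  | pred n ih =>
    obtain ⟨k, hk⟩ := ih
    obtain ⟨l, hl⟩ := h _ (hΩ x hx (-(n : ℤ) - 1))
    refine ⟨-l + k, ?_⟩
    simp only at hk ⊢
    rw [zIter_add, hk, ← zIter_neg_zIter S l (zIter T (-(n : ℤ) - 1) x), ← hl, ← zIter_one T,
      ← zIter_add]
    congr 2
    ring

end Iterates

/-! ### Choosing integers of minimal absolute value -/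

open Classical in
/-- An integer of minimal absolute value satisfying `P`, or `0` if there is none. -/
noncomputable def minInt (P : ℤ → Prop) : ℤ :=
  if h : ∃ n : ℕ, P n ∨ P (-n) then
    if P (Nat.find h) then Nat.find h else -(Nat.find h : ℤ)
  else 0

theorem minInt_spec {P : ℤ → Prop} {m : ℤ} (hm : P m) :
    P (minInt P) ∧ |minInt P| ≤ |m| := by
  classical
  have h0 : P m.natAbs ∨ P (-(m.natAbs : ℤ)) := by
    rcases Int.natAbs_eq m with h | h
    · left; rwa [← h]
    · right; rwa [← h]
  have h : ∃ n : ℕ, P n ∨ P (-n) := ⟨m.natAbs, h0⟩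
  have hs := Nat.find_spec h
  have hle : ((Nat.find h : ℕ) : ℤ) ≤ |m| := by
    rw [Int.abs_eq_natAbs]; exact_mod_cast Nat.find_min' h h0
  rw [minInt, dif_pos h]
  split_ifs with h1
  · exact ⟨h1, by simpa using hle⟩
  · exact ⟨hs.resolve_left h1, by simpa using hle⟩

theorem measurable_minInt {X : Type} [MeasurableSpace X] {P : X → ℤ → Prop}
    (hP : ∀ m, MeasurableSet {x | P x m}) : Measurable fun x => minInt (P x) := by
  classical
  have hQ : ∀ n : ℕ, MeasurableSet {x | P x n ∨ P x (-n)} := fun n => (hP _).union (hP _)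
  have hE : MeasurableSet {x | ∃ n : ℕ, P x n ∨ P x (-n)} := by
    simp only [ofPred_exists]
    exact MeasurableSet.iUnion hQ
  let R : X → ℕ → Prop := fun x n => (P x n ∨ P x (-n)) ∨ ¬ ∃ n : ℕ, P x n ∨ P x (-n)
  have hR : ∀ x, ∃ n, R x n := fun x => by
    by_cases h : ∃ n : ℕ, P x n ∨ P x (-n)
    · exact h.imp fun n hn => Or.inl hn
    · exact ⟨0, Or.inr h⟩
  have hf : Measurable fun x => Nat.find (hR x) :=
    measurable_find hR fun k => (hQ k).union hE.compl
  have hsel : MeasurableSet {x | P x (Nat.find (hR x))} := by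
    have : {x | P x (Nat.find (hR x))}
        = ⋃ n : ℕ, {x | Nat.find (hR x) = n} ∩ {x | P x n} := by
      ext x; simp
    rw [this]
    exact MeasurableSet.iUnion fun n => (hf (measurableSet_singleton n)).inter (hP n)
  have heq : (fun x => minInt (P x)) = fun x => if (∃ n : ℕ, P x n ∨ P x (-n)) then
      (if P x (Nat.find (hR x)) then ((Nat.find (hR x) : ℕ) : ℤ) else -(Nat.find (hR x) : ℤ))
      else 0 := by
    ext x
    unfold minInt
    by_cases h : ∃ n : ℕ, P x n ∨ P x (-n)
    · rw [dif_pos h, if_pos h]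
      have : Nat.find (hR x) = Nat.find h := by
        apply Nat.find_congr'
        intro n
        exact or_iff_left (not_not.2 h)
      rw [this]
    · rw [dif_neg h, if_neg h]
  rw [heq]
  have hc : Measurable fun x => ((Nat.find (hR x) : ℕ) : ℤ) := measurable_from_top.comp hf
  exact Measurable.ite hE (Measurable.ite hsel hc
    ((measurable_from_top (f := fun z : ℤ => -z)).comp hc)) measurable_const

/-! ### Integrability from tail bounds -/

theorem integrable_comp_abs_of_tail {X : Type} [MeasurableSpace X] {μ : Measure X}
    [IsFiniteMeasure μ] {φ : ℝ → ℝ} (hφ0 : ∀ t : ℝ, 0 ≤ t → 0 ≤ φ t) {c : X → ℤ}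
    (hc : Measurable c) {G : ℕ → Set X} (hG : ∀ N, MeasurableSet (G N)) {K : ℕ → ℕ} {C : ℕ → ℝ}
    (hC : ∀ N, ∀ t : ℕ, t ≤ K N → φ t ≤ C N)
    (hsum : ∑' N, ENNReal.ofReal (C (N + 1)) * μ (G N)ᶜ ≠ ⊤)
    (hcov : ∀ᵐ x ∂μ, ∃ N, x ∈ G N) (hcK : ∀ᵐ x ∂μ, ∀ N, x ∈ G N → |c x| ≤ K N) :
    Integrable (fun x => φ |(c x : ℝ)|) μ := by
  have hmeas : Measurable fun x => φ |(c x : ℝ)| :=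
    (measurable_from_top (f := fun z : ℤ => φ |(z : ℝ)|)).comp hc
  refine ⟨hmeas.aestronglyMeasurable, ?_⟩
  rw [hasFiniteIntegral_iff_ofReal (Eventually.of_forall fun x => hφ0 _ (abs_nonneg _))]
  have hle : ∀ᵐ x ∂μ, ENNReal.ofReal (φ |(c x : ℝ)|) ≤ ENNReal.ofReal (C 0) +
      ∑' N, (G N)ᶜ.indicator (fun _ => ENNReal.ofReal (C (N + 1))) x := by
    filter_upwards [hcov, hcK] with x hx hxK
    classical
    have hcast : |(c x : ℝ)| = ((c x).natAbs : ℝ) := by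
      rw [Nat.cast_natAbs, Int.cast_abs]
    have key : ∀ N, x ∈ G N → φ |(c x : ℝ)| ≤ C N := fun N hN => by
      rw [hcast]
      refine hC N _ ?_
      have := hxK N hN
      rw [Int.abs_eq_natAbs] at this
      exact_mod_cast this
    obtain ⟨N, hN, hmin⟩ : ∃ N, x ∈ G N ∧ ∀ k < N, x ∉ G k :=
      ⟨Nat.find hx, Nat.find_spec hx, fun k hk => Nat.find_min hx hk⟩
    cases N with
    | zero => exact (ENNReal.ofReal_le_ofReal (key 0 hN)).trans le_self_add
    | succ N =>
      refine (ENNReal.ofReal_le_ofReal (key _ hN)).trans (le_trans ?_ le_add_self)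
      refine le_trans ?_ (ENNReal.le_tsum N)
      rw [indicator_of_mem (hmin N N.lt_succ_self)]
  refine (lintegral_mono_ae hle).trans_lt ?_
  rw [lintegral_add_left measurable_const, lintegral_tsum
    fun N => (measurable_const.indicator (hG N).compl).aemeasurable]
  simp only [lintegral_indicator (hG _).compl, lintegral_const,
    Measure.restrict_apply_univ]
  exact ENNReal.add_lt_top.2
    ⟨ENNReal.mul_lt_top ENNReal.ofReal_lt_top (measure_lt_top _ _), hsum.lt_top⟩

/-! ### Level functions and odometers -/

section Levels

variable {X : Type}

/-- The levels of `y` are those of `x` shifted by `m`, modulo the heights. -/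
def LevShift (H : ℕ → ℕ) (lev : ℕ → X → ℕ) (m : ℤ) (x y : X) : Prop :=
  ∀ n, (lev n y : ℤ) ≡ lev n x + m [ZMOD H n]

variable {H : ℕ → ℕ} {lev : ℕ → X → ℕ}

theorem LevShift.refl (x : X) : LevShift H lev 0 x x := fun n => by simp

theorem LevShift.trans {m l : ℤ} {x y z : X} (h : LevShift H lev m x y)
    (h' : LevShift H lev l y z) : LevShift H lev (m + l) x z := fun n => by
  rw [← add_assoc]
  exact (h' n).trans ((h n).add_right l)

theorem LevShift.symm {m : ℤ} {x y : X} (h : LevShift H lev m x y) :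
    LevShift H lev (-m) y x := fun n => by
  have := ((h n).symm.add_right (-m))
  simpa using this

theorem LevShift.unique (hlt : ∀ n x, lev n x < H n)
    (hsep : ∀ x y, (∀ n, lev n x = lev n y) → x = y) {m : ℤ} {x y z : X}
    (h : LevShift H lev m x y) (h' : LevShift H lev m x z) : y = z := by
  refine hsep _ _ fun n => ?_
  have h1 : lev n y ≡ lev n z [MOD H n] := by
    rw [← Int.natCast_modEq_iff]; exact (h n).trans (h' n).symm
  exact Nat.ModEq.eq_of_lt_of_lt h1 (hlt n y) (hlt n z)

theorem measurableSet_levShift [MeasurableSpace X] (hlev : ∀ n, Measurable (lev n)) {f : X → X}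
    (hf : Measurable f) (m : ℤ) : MeasurableSet {x | LevShift H lev m x (f x)} := by
  simp only [LevShift, ofPred_forall]
  refine MeasurableSet.iInter fun n => ?_
  have : Measurable fun x => (lev n (f x), lev n x) := ((hlev n).comp hf).prodMk (hlev n)
  exact this (MeasurableSet.of_discrete (s := {p : ℕ × ℕ | (p.1 : ℤ) ≡ p.2 + m [ZMOD H n]}))

end Levels

theorem heights_eq_prod {p : ℕ → CSParam} (hσ : ∀ n i, (p n).σ i = 0) (n : ℕ) :
    heights p n = ∏ k ∈ Finset.range n, (p k).q := by
  induction n with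
  | zero => rfl
  | succ n ih => simp [heights, ih, Finset.prod_range_succ, CSParam.σtot, hσ, mul_comm]

theorem heights_pos (p : ℕ → CSParam) (n : ℕ) : 0 < heights p n := by
  induction n with
  | zero => exact one_pos
  | succ n ih => exact Nat.add_pos_left (Nat.mul_pos (by linarith [(p n).two_le_q]) ih) _

/-- A transformation that increments a separating family of levels is an odometer. -/
theorem isRankOneWith_of_levels {X : Type} [MeasurableSpace X] [StandardBorelSpace X]
    {μ : Measure X} {S : X ≃ᵐ X} (hS : MeasurePreserving S μ μ) {p : ℕ → CSParam}
    (hσ : ∀ n i, (p n).σ i = 0) {Ω : Set X} (hΩ : MeasurableSet Ω) (hμΩ : μ Ωᶜ = 0)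
    (hΩS : ∀ x ∈ Ω, ∀ k, zIter S k x ∈ Ω) {lev : ℕ → X → ℕ} (hlev : ∀ n, Measurable (lev n))
    (hlt : ∀ n x, lev n x < heights p n)
    (hmod : ∀ n x, lev (n + 1) x % heights p n = lev n x)
    (hsep : ∀ x y, (∀ n, lev n x = lev n y) → x = y)
    (hshift : ∀ x ∈ Ω, ∀ k, LevShift (heights p) lev k x (zIter S k x)) :
    IsRankOneWith μ S p := by
  have hsucc : ∀ n, heights p (n + 1) = (p n).q * heights p n := fun n => by
    simp [heights, CSParam.σtot, hσ]
  have himage : ∀ n k l, l + k < heights p n →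
      (⇑S)^[k] '' {x | x ∈ Ω ∧ lev n x = l} = {x | x ∈ Ω ∧ lev n x = l + k} := by
    intro n k l hk
    have hlev_of : ∀ x ∈ Ω, ∀ (j : ℤ) (i : ℕ), (i : ℤ) = lev n x + j → i < heights p n →
        lev n (zIter S j x) = i := by
      intro x hx j i hi hlt'
      have h1 := hshift x hx j n
      rw [← hi, Int.natCast_modEq_iff] at h1
      exact h1.eq_of_lt_of_lt (hlt _ _) hlt'
    ext y
    constructor
    · rintro ⟨x, ⟨hx, hxl⟩, rfl⟩
      rw [← zIter_natCast]
      exact ⟨hΩS x hx _, hlev_of x hx k _ (by push_cast [hxl]; ring) hk⟩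
    · rintro ⟨hy, hyl⟩
      refine ⟨zIter S (-k) y, ⟨hΩS y hy _, hlev_of y hy (-k) _ (by push_cast [hyl]; ring)
        (by omega)⟩, ?_⟩
      rw [← zIter_natCast, zIter_zIter_neg]
  have himage0 : ∀ n k, k < heights p n →
      (⇑S)^[k] '' {x | x ∈ Ω ∧ lev n x = 0} = {x | x ∈ Ω ∧ lev n x = k} := by
    intro n k hk
    rw [himage n k 0 (by omega), zero_add]
  have hlevel : ∀ n k, MeasurableSet {x | x ∈ Ω ∧ lev n x = k} := fun n k =>
    hΩ.inter (hlev n (measurableSet_singleton k))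
  have hcol : ∀ n i, colStart p n i = i * heights p n := fun n i => by simp [colStart, hσ]
  have hlt_succ : ∀ n i k, i < (p n).q → k < heights p n →
      i * heights p n + k < heights p (n + 1) := by
    intro n i k hi hk
    rw [hsucc]
    calc i * heights p n + k < (i + 1) * heights p n := by rw [add_one_mul]; omega
      _ ≤ _ := Nat.mul_le_mul_right _ hi
  refine ⟨hS, ?_, fun n => {x | x ∈ Ω ∧ lev n x = 0},
    fun n i => {x | x ∈ Ω ∧ lev (n + 1) x = i * heights p n}, ?_, ?_⟩
  · simp [CondF, CSParam.σtot, hσ]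
  · refine ⟨fun n => hlevel n 0, fun n i _ => hlevel _ _, ?_, ?_, ?_, ?_, ?_⟩
    · intro n k hk l hl hkl
      rw [himage0 n k hk, himage0 n l hl]
      exact Set.disjoint_left.2 fun x hx hx' => hkl (hx.2.symm.trans hx'.2)
    · intro n i _ j _ hij
      refine Set.disjoint_left.2 fun x hx hx' => hij ?_
      exact Nat.eq_of_mul_eq_mul_right (heights_pos p n) (hx.2.symm.trans hx'.2)
    · intro n
      ext x
      simp only [mem_ofPred_eq, Finset.mem_range, mem_iUnion, exists_prop]
      constructor
      · rintro ⟨hx, h0⟩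
        refine ⟨lev (n + 1) x / heights p n, ?_, hx, ?_⟩
        · rw [Nat.div_lt_iff_lt_mul (heights_pos p n), ← hsucc]
          exact hlt _ _
        · rw [← hmod] at h0
          exact (Nat.div_mul_cancel (Nat.dvd_of_mod_eq_zero h0)).symm
      · rintro ⟨i, _, hx, hi⟩
        exact ⟨hx, by rw [← hmod, hi, Nat.mul_mod_left]⟩
    · intro n i hi k hk
      rw [hcol, himage0 _ _ (hlt_succ n i k hi hk), himage _ _ _ (hlt_succ n i k hi hk)]
    · intro n l hl hno
      exfalso
      refine hno (l / heights p n) ?_ (l % heights p n) (Nat.mod_lt _ (heights_pos p n)) ?_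
      · rwa [Nat.div_lt_iff_lt_mul (heights_pos p n), ← hsucc]
      · rw [hcol, mul_comm, Nat.div_add_mod]
  · intro A hA
    classical
    let L : X → ℕ → ℕ := fun x n => if x ∈ Ω then lev n x + 1 else 0
    have hL : Measurable L := measurable_pi_lambda _ fun n =>
      Measurable.ite hΩ ((hlev n).add_const 1) measurable_const
    have hinj : InjOn L Ω := by
      intro x hx y hy hxy
      refine hsep x y fun n => ?_
      have := congrFun hxy n
      simpa [L, hx, hy] using this
    have him : MeasurableSet (L '' (A ∩ Ω)) :=
      (hA.inter hΩ).image_of_measurable_injOn hL (hinj.mono inter_subset_right)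
    set 𝒢 := MeasurableSpace.generateFrom
      {s : Set X | ∃ n k, k < heights p n ∧ s = (⇑S)^[k] '' {x | x ∈ Ω ∧ lev n x = 0}} with h𝒢
    have hgen : ∀ n k, MeasurableSet[𝒢] {x | x ∈ Ω ∧ lev n x = k} := by
      intro n k
      by_cases hk : k < heights p n
      · exact MeasurableSpace.measurableSet_generateFrom ⟨n, k, hk, (himage0 n k hk).symm⟩
      · have : {x | x ∈ Ω ∧ lev n x = k} = ∅ :=
          eq_empty_of_forall_notMem fun x hx => hk (hx.2 ▸ hlt n x)
        rw [this]
        exact @MeasurableSet.empty _ 𝒢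
    have hΩ𝒢 : MeasurableSet[𝒢] Ω := by
      have : Ω = {x | x ∈ Ω ∧ lev 0 x = 0} := by
        ext x
        have := hlt 0 x
        simp only [heights, Nat.lt_one_iff] at this
        simp [this]
      rw [this]
      exact hgen 0 0
    have hL𝒢 : Measurable[𝒢] L := by
      refine @measurable_pi_lambda _ _ _ 𝒢 _ L fun n => ?_
      refine @measurable_to_countable' _ _ _ _ 𝒢 _ fun k => ?_
      cases k with
      | zero =>
        have : (fun x => L x n) ⁻¹' {0} = Ωᶜ := by
          ext x; by_cases hx : x ∈ Ω <;> simp [L, hx]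
        rw [this]
        exact hΩ𝒢.compl
      | succ k =>
        have : (fun x => L x n) ⁻¹' {k + 1} = {x | x ∈ Ω ∧ lev n x = k} := by
          ext x; by_cases hx : x ∈ Ω <;> simp [L, hx]
        rw [this]
        exact hgen n k
    refine ⟨Ω ∩ L ⁻¹' (L '' (A ∩ Ω)), hΩ𝒢.inter (hL𝒢 him), measure_mono_null ?_ hμΩ⟩
    have hE : Ω ∩ L ⁻¹' (L '' (A ∩ Ω)) = A ∩ Ω := by
      ext x
      constructor
      · rintro ⟨hx, y, hy, hxy⟩
        rwa [← hinj hy.2 hx hxy]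
      · intro hx
        exact ⟨hx.2, x, hx, rfl⟩
    rw [hE]
    intro x hx hxΩ
    rcases hx with ⟨h1, h2⟩ | ⟨h1, h2⟩
    · exact h2 ⟨h1, hxΩ⟩
    · exact h2 h1.1

/-- Orbit equivalence with the universal odometer, from level functions which are shifted by one
along orbits of `T`, with tail bounds on the size of the shifts. -/
theorem phiOEToUnivOdometer_of_levels {X : Type} [MeasurableSpace X] [StandardBorelSpace X]
    {μ : Measure X} [IsProbabilityMeasure μ] [NullSingletonClass μ] {T : X ≃ᵐ X}
    (hT : MeasurePreserving T μ μ) {φ : ℝ → ℝ} (hφ0 : ∀ t : ℝ, 0 ≤ t → 0 ≤ φ t)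
    {p : ℕ → CSParam} (hσ : ∀ n i, (p n).σ i = 0)
    (hdvd : ∀ N : ℕ, 0 < N → ∃ n, N ∣ ∏ k ∈ Finset.range n, (p k).q)
    {lev : ℕ → X → ℕ} (hlev : ∀ n, Measurable (lev n))
    (hlt : ∀ n x, lev n x < heights p n)
    (hmod : ∀ n x, lev (n + 1) x % heights p n = lev n x)
    (hsep : ∀ x y, (∀ n, lev n x = lev n y) → x = y)
    {G : ℕ → Set X} (hG : ∀ N, MeasurableSet (G N)) {K : ℕ → ℕ} {C : ℕ → ℝ}
    (hC : ∀ N, ∀ t : ℕ, t ≤ K N → φ t ≤ C N)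
    (hsum : ∑' N, ENNReal.ofReal (C (N + 1)) * μ (G N)ᶜ ≠ ⊤)
    (hcov : ∀ᵐ x ∂μ, ∃ N, x ∈ G N)
    (hnext : ∀ N, ∀ x ∈ G N, ∃ m : ℤ, |m| ≤ K N ∧ LevShift (heights p) lev 1 x (zIter T m x))
    (hprev : ∀ N, ∀ x ∈ G N, ∃ m : ℤ, LevShift (heights p) lev (-1) x (zIter T m x))
    (hstep : ∀ N, ∀ x ∈ G N, ∃ m : ℤ, |m| ≤ K N ∧ LevShift (heights p) lev m x (T x)) :
    PhiOEToUnivOdometer μ T φ := by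
  classical
  have huniq : ∀ {m : ℤ} {x y z : X}, LevShift (heights p) lev m x y →
      LevShift (heights p) lev m x z → y = z := fun h h' => h.unique hlt hsep h'
  set cS : X → ℤ := fun x => minInt fun m => LevShift (heights p) lev 1 x (zIter T m x) with hcS
  set cS' : X → ℤ := fun x => minInt fun m => LevShift (heights p) lev (-1) x (zIter T m x)
    with hcS'
  set cT : X → ℤ := fun x => minInt fun m => LevShift (heights p) lev m x (T x) with hcT
  have hcSm : Measurable cS := measurable_minInt fun m =>
    measurableSet_levShift hlev (measurable_zIter T m) 1
  have hcSm' : Measurable cS' := measurable_minInt fun m =>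
    measurableSet_levShift hlev (measurable_zIter T m) (-1)
  have hcTm : Measurable cT := measurable_minInt fun m =>
    measurableSet_levShift hlev T.measurable m
  -- the invariant set on which everything is defined
  set Ω : Set X := {x | ∀ k : ℤ, ∃ N, zIter T k x ∈ G N} with hΩdef
  have hΩ : MeasurableSet Ω := by
    have : Ω = ⋂ k : ℤ, ⋃ N, zIter T k ⁻¹' G N := by ext x; simp [hΩdef]
    rw [this]
    exact MeasurableSet.iInter fun k => MeasurableSet.iUnion fun N => measurable_zIter T k (hG N)
  have hΩT : ∀ x ∈ Ω, ∀ k, zIter T k x ∈ Ω := fun x hx k l => by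
    rw [← zIter_add]; exact hx _
  have hΩG : ∀ x ∈ Ω, ∃ N, x ∈ G N := fun x hx => by simpa [zIter_zero] using hx 0
  have hΩae : ∀ᵐ x ∂μ, x ∈ Ω := by
    rw [hΩdef]
    simp only [mem_ofPred_eq]
    rw [ae_all_iff]
    exact fun k => (measurePreserving_zIter hT k).quasiMeasurePreserving.ae hcov
  have hS1 : ∀ x ∈ Ω, LevShift (heights p) lev 1 x (zIter T (cS x) x) := fun x hx => by
    obtain ⟨N, hN⟩ := hΩG x hx
    obtain ⟨m, -, hm⟩ := hnext N x hN
    exact (minInt_spec (P := fun m => LevShift (heights p) lev 1 x (zIter T m x)) hm).1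
  have hS1' : ∀ x ∈ Ω, LevShift (heights p) lev (-1) x (zIter T (cS' x) x) := fun x hx => by
    obtain ⟨N, hN⟩ := hΩG x hx
    obtain ⟨m, hm⟩ := hprev N x hN
    exact (minInt_spec (P := fun m => LevShift (heights p) lev (-1) x (zIter T m x)) hm).1
  have hT1 : ∀ x ∈ Ω, LevShift (heights p) lev (cT x) x (T x) := fun x hx => by
    obtain ⟨N, hN⟩ := hΩG x hx
    obtain ⟨m, -, hm⟩ := hstep N x hN
    exact (minInt_spec (P := fun m => LevShift (heights p) lev m x (T x)) hm).1
  let S : X ≃ᵐ X :=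
    { toFun := fun x => if x ∈ Ω then zIter T (cS x) x else x
      invFun := fun x => if x ∈ Ω then zIter T (cS' x) x else x
      left_inv := fun x => by
        by_cases hx : x ∈ Ω
        · have hx' := hΩT x hx (cS x)
          simp only [hx, hx', if_true]
          exact huniq (hS1' _ hx') (hS1 x hx).symm
        · simp [hx]
      right_inv := fun x => by
        by_cases hx : x ∈ Ω
        · have hx' := hΩT x hx (cS' x)
          simp only [hx, hx', if_true]
          have := (hS1' x hx).symm
          rw [neg_neg] at this
          exact huniq (hS1 _ hx') this
        · simp [hx]
      measurable_toFun := Measurable.ite hΩ (measurable_zIter_comp T hcSm) measurable_id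
      measurable_invFun := Measurable.ite hΩ (measurable_zIter_comp T hcSm') measurable_id }
  have hSx : ∀ x ∈ Ω, S x = zIter T (cS x) x := fun x hx => if_pos hx
  have hSx' : ∀ x ∈ Ω, S.symm x = zIter T (cS' x) x := fun x hx => if_pos hx
  have hΩS : ∀ x ∈ Ω, S x ∈ Ω := fun x hx => by rw [hSx x hx]; exact hΩT x hx _
  have hΩS' : ∀ x ∈ Ω, S.symm x ∈ Ω := fun x hx => by rw [hSx' x hx]; exact hΩT x hx _
  have hSmp : MeasurePreserving S μ μ := by
    refine measurePreserving_of_eq_zIter hT S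
      (c := fun x => if x ∈ Ω then cS x else 0) (Measurable.ite hΩ hcSm measurable_const) ?_
    intro x
    by_cases hx : x ∈ Ω
    · rw [hSx x hx, if_pos hx]
    · rw [if_neg hx, zIter_zero]; exact if_neg hx
  have hSshift : ∀ x ∈ Ω, ∀ k, zIter S k x ∈ Ω ∧
      LevShift (heights p) lev k x (zIter S k x) := by
    intro x hx k
    induction k using Int.induction_on with
    | zero => rw [zIter_zero]; exact ⟨hx, LevShift.refl x⟩
    | succ n ih =>
      rw [add_comm (n : ℤ), zIter_add, zIter_one]
      refine ⟨hΩS _ ih.1, ?_⟩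
      rw [add_comm, hSx _ ih.1]
      exact ih.2.trans (hS1 _ ih.1)
    | pred n ih =>
      have h1 : zIter S (-(n : ℤ) - 1) x = S.symm (zIter S (-n) x) := by
        rw [sub_eq_add_neg, add_comm, zIter_add, S.eq_symm_apply, ← zIter_one, zIter_zIter_neg]
      rw [h1]
      refine ⟨hΩS' _ ih.1, ?_⟩
      rw [hSx' _ ih.1]
      exact ih.2.trans (hS1' _ ih.1)
  have hTS : ∀ x ∈ Ω, T x = zIter S (cT x) x := fun x hx =>
    huniq (hT1 x hx) (hSshift x hx _).2
  have hrank : IsRankOneWith μ S p :=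
    isRankOneWith_of_levels hSmp hσ hΩ (ae_iff.1 hΩae) (fun x hx k => (hSshift x hx k).1) hlev hlt
      hmod hsep fun x hx k => (hSshift x hx k).2
  refine ⟨⟨X, μ, S⟩, ⟨‹_›, ‹_›, ‹_›⟩, ⟨p, hrank, hσ, hdvd⟩, MeasurableEquiv.refl X,
    MeasurePreserving.id μ, ?_, cT, cS, hcTm, hcSm, ?_, ?_, ?_, ?_⟩
  · filter_upwards [hΩae] with x hx
    have h1 : orbit T x ⊆ orbit S x :=
      orbit_subset_of_step hΩT (fun y hy => ⟨_, hTS y hy⟩) hx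
    have h2 : orbit S x ⊆ orbit T x :=
      orbit_subset_of_step (fun y hy k => (hSshift y hy k).1) (fun y hy => ⟨_, hSx y hy⟩) hx
    simpa using h1.antisymm h2
  · filter_upwards [hΩae] with x hx using hTS x hx
  · filter_upwards [hΩae] with x hx using hSx x hx
  · refine integrable_comp_abs_of_tail hφ0 hcTm hG hC hsum hcov (Eventually.of_forall ?_)
    intro x N hN
    obtain ⟨m, hmK, hm⟩ := hstep N x hN
    exact (minInt_spec (P := fun m => LevShift (heights p) lev m x (T x)) hm).2.trans hmK
  · refine integrable_comp_abs_of_tail hφ0 hcSm hG hC hsum hcov (Eventually.of_forall ?_)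
    intro x N hN
    obtain ⟨m, hmK, hm⟩ := hnext N x hN
    exact (minInt_spec (P := fun m => LevShift (heights p) lev 1 x (zIter T m x)) hm).2.trans hmK

/-! ### Well-approximated angles -/

/-- Numerators and denominators of successive rational approximations `P n / Q n` of an angle,
with `P (n + 1) / Q (n + 1) = P n / Q n + 1 / Q (n + 1)` and `Q` growing fast enough. -/
structure RotData where
  Q : ℕ → ℕ
  P : ℕ → ℤ
  s : ℕ → ℕ
  two_le_zero : 2 ≤ Q 0
  coprime_zero : IsCoprime (P 0) (Q 0 : ℤ)
  Q_succ' : ∀ n, Q (n + 1) = Q n * (Q n ^ 5 * s n)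
  P_succ' : ∀ n, P (n + 1) = P n * (Q n ^ 5 * s n : ℕ) + 1
  s_pos : ∀ n, 0 < s n
  s_le : ∀ n, 2 * s n ≤ Q n ^ 3
  dvd_s : ∀ n, n + 2 ∣ s n

namespace RotData

variable (D : RotData)

/-- The ratio `Q (n + 1) / Q n`. -/
def w (n : ℕ) : ℕ := D.Q n ^ 5 * D.s n

theorem Q_succ (n : ℕ) : D.Q (n + 1) = D.Q n * D.w n := D.Q_succ' n

theorem P_succ (n : ℕ) : D.P (n + 1) = D.P n * D.w n + 1 := D.P_succ' n

theorem two_le_Q (n : ℕ) : 2 ≤ D.Q n := by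
  induction n with
  | zero => exact D.two_le_zero
  | succ n ih =>
    rw [D.Q_succ']
    have := D.s_pos n
    have h5 : 0 < D.Q n ^ 5 := by positivity
    exact ih.trans (Nat.le_mul_of_pos_right _ (Nat.mul_pos h5 this))

theorem Q_pos (n : ℕ) : 0 < D.Q n := by linarith [D.two_le_Q n]

theorem Q_le_w (n : ℕ) : D.Q n ≤ D.w n :=
  calc D.Q n = D.Q n ^ 1 * 1 := by ring
    _ ≤ D.Q n ^ 5 * D.s n :=
      Nat.mul_le_mul (Nat.pow_le_pow_right (D.Q_pos n) (by norm_num)) (D.s_pos n)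

theorem two_le_w (n : ℕ) : 2 ≤ D.w n := (D.two_le_Q n).trans (D.Q_le_w n)

theorem w_pos (n : ℕ) : 0 < D.w n := by linarith [D.two_le_w n]

theorem Q_dvd_w (n : ℕ) : D.Q n ∣ D.w n :=
  Dvd.dvd.mul_right (dvd_pow_self _ (by norm_num)) _

theorem two_mul_Q_le (n : ℕ) : 2 * D.Q n ≤ D.Q (n + 1) := by
  rw [D.Q_succ, mul_comm]
  exact Nat.mul_le_mul_left _ (D.two_le_w n)

theorem Q_mono : Monotone D.Q := monotone_nat_of_le_succ fun n => by
  have := D.two_mul_Q_le n; omega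

theorem two_pow_mul_le (n k : ℕ) : 2 ^ k * D.Q n ≤ D.Q (n + k) := by
  induction k with
  | zero => simp
  | succ k ih =>
    have := D.two_mul_Q_le (n + k)
    rw [pow_succ, ← add_assoc]
    linarith

theorem coprime (n : ℕ) : IsCoprime (D.P n) (D.Q n : ℤ) := by
  cases n with
  | zero => exact D.coprime_zero
  | succ n =>
    rw [D.P_succ, D.Q_succ, Nat.cast_mul]
    have h1 : IsCoprime (D.P n * (D.w n : ℤ) + 1) (D.w n : ℤ) := ⟨1, -D.P n, by ring⟩
    exact (h1.of_isCoprime_of_dvd_right (Int.natCast_dvd_natCast.2 (D.Q_dvd_w n))).mul_right h1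

/-! #### Levels of the periodic rotations -/

theorem exists_inv (n : ℕ) : ∃ u : ℤ, u * D.P n ≡ 1 [ZMOD D.Q n] := by
  obtain ⟨a, b, h⟩ := D.coprime n
  refine ⟨a, ?_⟩
  rw [← h]
  refine (Int.modEq_iff_dvd.2 ⟨b, ?_⟩)
  ring

/-- The time needed by the rotation of angle `P n / Q n` to bring `0` to position `j / Q n`. -/
noncomputable def tl (n j : ℕ) : ℕ := ((j * (D.exists_inv n).choose : ℤ) % D.Q n).toNat

theorem tl_modEq (n j : ℕ) : (D.tl n j : ℤ) ≡ j * (D.exists_inv n).choose [ZMOD D.Q n] := by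
  have hQ : (0 : ℤ) < D.Q n := by exact_mod_cast D.Q_pos n
  rw [tl, Int.toNat_of_nonneg (Int.emod_nonneg _ hQ.ne')]
  exact Int.mod_modEq _ _

theorem tl_lt (n j : ℕ) : D.tl n j < D.Q n := by
  have hQ : (0 : ℤ) < D.Q n := by exact_mod_cast D.Q_pos n
  have := Int.emod_lt_of_pos (j * (D.exists_inv n).choose : ℤ) hQ
  rw [tl]
  omega

theorem tl_mul_modEq (n j : ℕ) : (D.tl n j : ℤ) * D.P n ≡ j [ZMOD D.Q n] := by
  have h1 := (D.tl_modEq n j).mul_right (D.P n)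
  have h2 := (D.exists_inv n).choose_spec.mul_left (j : ℤ)
  rw [← mul_assoc, mul_one] at h2
  exact h1.trans h2

theorem tl_shift {n j j' : ℕ} {m : ℤ} (h : (j' : ℤ) ≡ j + m * D.P n [ZMOD D.Q n]) :
    (D.tl n j' : ℤ) ≡ D.tl n j + m [ZMOD D.Q n] := by
  have h1 := h.mul_right (D.exists_inv n).choose
  have h2 := (D.exists_inv n).choose_spec.mul_left m
  refine (D.tl_modEq n j').trans (h1.trans ?_)
  rw [add_mul]
  refine (D.tl_modEq n j).symm.add ?_
  rw [mul_one] at h2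
  rwa [mul_assoc, mul_comm (D.P n)]

theorem tl_inj {n j j' : ℕ} (hj : j < D.Q n) (hj' : j' < D.Q n) (h : D.tl n j = D.tl n j') :
    j = j' := by
  have h1 := D.tl_mul_modEq n j
  rw [h] at h1
  have h2 := h1.symm.trans (D.tl_mul_modEq n j')
  exact Nat.ModEq.eq_of_lt_of_lt (Int.natCast_modEq_iff.1 h2) hj hj'

/-! #### Levels of the odometer -/

/-- The column of the `n`-th tower of the rotation containing the position `j / Q (n + 1)`. -/
noncomputable def col (n j : ℕ) : ℕ := (j % D.w n + D.w n - D.tl n (j / D.w n)) % D.w n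

/-- The rank at which a column is stacked. -/
def rk (n c : ℕ) : ℕ := c / D.Q n + c % D.Q n * (D.w n / D.Q n)

/-- The level of the odometer containing the position `j / Q n`. -/
noncomputable def sl : ℕ → ℕ → ℕ
  | 0, j => j
  | n + 1, j => sl n (j / D.w n) + D.Q n * D.rk n (D.col n j)

theorem col_lt (n j : ℕ) : D.col n j < D.w n := Nat.mod_lt _ (D.w_pos n)

theorem rk_lt {n c : ℕ} (hc : c < D.w n) : D.rk n c < D.w n := by
  obtain ⟨v, hv⟩ := D.Q_dvd_w n
  have hQ := D.Q_pos n
  rw [hv] at hc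
  rw [rk, hv, Nat.mul_div_cancel_left _ hQ]
  have h1 : c / D.Q n < v := by rwa [Nat.div_lt_iff_lt_mul hQ, mul_comm]
  have h2 : c % D.Q n + 1 ≤ D.Q n := Nat.mod_lt _ hQ
  calc _ < (c % D.Q n + 1) * v := by rw [add_one_mul]; omega
    _ ≤ _ := Nat.mul_le_mul_right _ h2

theorem rk_inj {n c c' : ℕ} (hc : c < D.w n) (hc' : c' < D.w n) (h : D.rk n c = D.rk n c') :
    c = c' := by
  obtain ⟨v, hv⟩ := D.Q_dvd_w n
  have hQ := D.Q_pos n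
  rw [hv] at hc hc'
  rw [rk, rk, hv, Nat.mul_div_cancel_left _ hQ] at h
  have h1 : c / D.Q n < v := by rwa [Nat.div_lt_iff_lt_mul hQ, mul_comm]
  have h1' : c' / D.Q n < v := by rwa [Nat.div_lt_iff_lt_mul hQ, mul_comm]
  have hv0 : 0 < v := (Nat.zero_le _).trans_lt h1
  have hdiv := congrArg (· % v) h
  simp only [Nat.add_mul_mod_self_right, Nat.mod_eq_of_lt h1, Nat.mod_eq_of_lt h1'] at hdiv
  rw [hdiv] at h
  have hm := Nat.eq_of_mul_eq_mul_right hv0 (Nat.add_left_cancel h)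
  rw [← Nat.div_add_mod c (D.Q n), hdiv, hm, Nat.div_add_mod]

theorem rk_add (n c : ℕ) : D.rk n (c + D.Q n) = D.rk n c + 1 := by
  rw [rk, rk, Nat.add_div_right _ (D.Q_pos n), Nat.add_mod_right]
  ring

theorem div_lt {n j : ℕ} (hj : j < D.Q (n + 1)) : j / D.w n < D.Q n := by
  rwa [Nat.div_lt_iff_lt_mul (D.w_pos n), ← D.Q_succ]

theorem sl_lt {n j : ℕ} (hj : j < D.Q n) : D.sl n j < D.Q n := by
  induction n generalizing j with
  | zero => exact hj
  | succ n ih =>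
    have h1 := ih (D.div_lt hj)
    have h2 := D.rk_lt (D.col_lt n j)
    rw [sl, D.Q_succ]
    calc _ < D.Q n * (D.rk n (D.col n j) + 1) := by rw [mul_add_one]; omega
      _ ≤ _ := Nat.mul_le_mul_left _ h2

theorem sl_mod {n j : ℕ} (hj : j < D.Q (n + 1)) :
    D.sl (n + 1) j % D.Q n = D.sl n (j / D.w n) := by
  rw [sl, Nat.add_mul_mod_self_left, Nat.mod_eq_of_lt (D.sl_lt (D.div_lt hj))]

theorem col_inj {n j j' : ℕ} (hdiv : j / D.w n = j' / D.w n) (h : D.col n j = D.col n j') :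
    j = j' := by
  have hw := D.w_pos n
  rw [col, col, hdiv] at h
  have hA := (D.tl_lt n (j' / D.w n)).trans_le (D.Q_le_w n)
  have h1 : j % D.w n ≡ j' % D.w n [MOD D.w n] := by
    have h2 : j % D.w n + D.w n - D.tl n (j' / D.w n) + D.tl n (j' / D.w n)
        ≡ j' % D.w n + D.w n - D.tl n (j' / D.w n) + D.tl n (j' / D.w n) [MOD D.w n] :=
      Nat.ModEq.add_right _ h
    rw [Nat.sub_add_cancel (by omega), Nat.sub_add_cancel (by omega)] at h2
    exact Nat.ModEq.add_right_cancel' _ h2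
  have h3 := h1.eq_of_lt_of_lt (Nat.mod_lt _ hw) (Nat.mod_lt _ hw)
  rw [← Nat.div_add_mod j (D.w n), hdiv, h3, Nat.div_add_mod]

theorem sl_inj {n j j' : ℕ} (hj : j < D.Q n) (hj' : j' < D.Q n) (h : D.sl n j = D.sl n j') :
    j = j' := by
  induction n generalizing j j' with
  | zero => exact h
  | succ n ih =>
    have hdiv : j / D.w n = j' / D.w n :=
      ih (D.div_lt hj) (D.div_lt hj') (by rw [← D.sl_mod hj, ← D.sl_mod hj', h])
    rw [sl, sl, hdiv] at h
    exact D.col_inj hdiv (D.rk_inj (D.col_lt n j) (D.col_lt n j')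
      (Nat.eq_of_mul_eq_mul_left (D.Q_pos n) (Nat.add_left_cancel h)))

theorem exists_sl_eq {n b : ℕ} (hb : b < D.Q n) : ∃ j < D.Q n, D.sl n j = b := by
  have hinj : Function.Injective fun j : Fin (D.Q n) => (⟨D.sl n j, D.sl_lt j.2⟩ : Fin (D.Q n)) :=
    fun j j' h => Fin.ext (D.sl_inj j.2 j'.2 (congrArg Fin.val h))
  obtain ⟨j, hj⟩ := (Finite.surjective_of_injective hinj) ⟨b, hb⟩
  exact ⟨j, j.2, congrArg Fin.val hj⟩

/-! #### Shifting positions -/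

/-- The position `j / Q (n + 1)` is far from the boundaries of the intervals of length `1 / Q n`
and from both ends of the tower of height `Q (n + 1)`. -/
def Good (n j : ℕ) : Prop :=
  (4 * D.Q n ≤ j % D.w n ∧ j % D.w n + 4 * D.Q n < D.w n) ∧
    (2 * D.Q n ≤ D.tl (n + 1) j ∧ D.tl (n + 1) j + 2 * D.Q n < D.Q (n + 1))

theorem eq_of_modEq_of_bounds {a b q : ℤ} (h : a ≡ b [ZMOD q]) (ha : 0 ≤ a) (ha' : a < q)
    (hb : 0 ≤ b) (hb' : b < q) : a = b := by
  have := h.eq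
  rwa [Int.emod_eq_of_lt ha ha', Int.emod_eq_of_lt hb hb'] at this

theorem sl_succ_shift {n j j' : ℕ} {m ε : ℤ} (hg : D.Good n j)
    (hm : |m| ≤ 2 * D.Q n) (hε : |ε| ≤ 1)
    (h : (j' : ℤ) ≡ j + m * D.P (n + 1) [ZMOD D.Q (n + 1)])
    (htl : (D.tl n (j' / D.w n) : ℤ) = D.tl n (j / D.w n) + m - ε * D.Q n) :
    (D.sl (n + 1) j' : ℤ) - D.sl (n + 1) j
      = D.sl n (j' / D.w n) - D.sl n (j / D.w n) + ε * D.Q n := by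
  obtain ⟨⟨hu1, hu2⟩, -⟩ := hg
  have hw := D.w_pos n
  have hA := D.tl_lt n (j / D.w n)
  have hA' := D.tl_lt n (j' / D.w n)
  have hu'lt : j' % D.w n < D.w n := Nat.mod_lt _ hw
  obtain ⟨hm1, hm2⟩ := abs_le.1 hm
  have hu : ((j' % D.w n : ℕ) : ℤ) = (j % D.w n : ℕ) + m := by
    refine eq_of_modEq_of_bounds (q := D.w n) ?_ (by positivity) (by exact_mod_cast hu'lt)
      (by omega) (by omega)
    push_cast
    have h1 : (j' : ℤ) ≡ j + m * D.P (n + 1) [ZMOD D.w n] :=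
      h.of_dvd (by rw [D.Q_succ]; exact_mod_cast Dvd.intro_left _ rfl)
    have h2 : m * D.P (n + 1) ≡ m [ZMOD D.w n] := by
      rw [D.P_succ]
      exact Int.modEq_iff_dvd.2 ⟨-(m * D.P n), by ring⟩
    exact (Int.mod_modEq _ _).trans
      (h1.trans ((Int.mod_modEq (j : ℤ) (D.w n)).symm.add h2))
  have hcol : D.col n j = j % D.w n - D.tl n (j / D.w n) := by
    rw [col, show j % D.w n + D.w n - D.tl n (j / D.w n)
      = (j % D.w n - D.tl n (j / D.w n)) + D.w n by omega, Nat.add_mod_right,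
      Nat.mod_eq_of_lt (by omega)]
  have hcol' : D.col n j' = j' % D.w n - D.tl n (j' / D.w n) := by
    rw [col, show j' % D.w n + D.w n - D.tl n (j' / D.w n)
      = (j' % D.w n - D.tl n (j' / D.w n)) + D.w n by omega, Nat.add_mod_right,
      Nat.mod_eq_of_lt (by omega)]
  have hrk : (D.rk n (D.col n j') : ℤ) = D.rk n (D.col n j) + ε := by
    have : ε = -1 ∨ ε = 0 ∨ ε = 1 := by have := abs_le.1 hε; omega
    rcases this with rfl | rfl | rfl
    · have : D.col n j = D.col n j' + D.Q n := by omega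
      rw [this, D.rk_add]; push_cast; ring
    · have : D.col n j' = D.col n j := by omega
      rw [this]; ring
    · have : D.col n j' = D.col n j + D.Q n := by omega
      rw [this, D.rk_add]; push_cast; ring
  rw [sl, sl]
  push_cast
  rw [hrk]
  ring

/-- Shifting a good sequence of positions by `m` shifts all its levels by the same amount. -/
theorem sl_shift {J J' : ℕ → ℕ} (hJ : ∀ n, J n = J (n + 1) / D.w n)
    (hJ' : ∀ n, J' n = J' (n + 1) / D.w n) {N : ℕ} {m ε : ℤ}
    (hg : ∀ k ≥ N, D.Good k (J (k + 1)))
    (hm : |m| ≤ 2 * D.Q N) (hε : |ε| ≤ 1)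
    (h : ∀ k ≥ N, (J' k : ℤ) ≡ J k + m * D.P k [ZMOD D.Q k])
    (htl : (D.tl N (J' N) : ℤ) = D.tl N (J N) + m - ε * D.Q N) {k : ℕ} (hk : N + 1 ≤ k) :
    (D.sl k (J' k) : ℤ) - D.sl k (J k) = D.sl N (J' N) - D.sl N (J N) + ε * D.Q N := by
  induction k, hk using Nat.le_induction with
  | base =>
    rw [hJ' N, hJ N]
    rw [hJ' N, hJ N] at htl
    exact D.sl_succ_shift (hg N le_rfl) hm hε (h _ (Nat.le_succ N)) htl
  | succ k hk ih =>
    rw [← ih]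
    obtain ⟨i, rfl⟩ : ∃ i, k = i + 1 := ⟨k - 1, by omega⟩
    have hQ1 : D.Q N ≤ D.Q i := D.Q_mono (by omega)
    have hQ2 : D.Q i ≤ D.Q (i + 1) := D.Q_mono (by omega)
    obtain ⟨-, h1, h2⟩ := hg i (by omega)
    obtain ⟨hm1, hm2⟩ := abs_le.1 hm
    have htl' : (D.tl (i + 1) (J' (i + 1)) : ℤ) = D.tl (i + 1) (J (i + 1)) + m := by
      refine eq_of_modEq_of_bounds (D.tl_shift (h (i + 1) (by omega))) (by positivity)
        (by exact_mod_cast D.tl_lt _ _) (by omega) (by omega)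
    have := D.sl_succ_shift (m := m) (ε := 0) (hg (i + 1) (by omega)) (by omega) (by simp)
      (h _ (by omega)) (by rw [← hJ, ← hJ', htl']; ring)
    rw [← hJ, ← hJ'] at this
    rw [this]
    ring

/-! #### The angle -/

theorem Q_pos_real (n : ℕ) : (0 : ℝ) < D.Q n := by exact_mod_cast D.Q_pos n

theorem one_div_Q_add_le (n k : ℕ) : (1 : ℝ) / D.Q (n + k) ≤ 1 / D.Q n * (1 / 2) ^ k := by
  have hn := D.Q_pos_real n
  have h : (2 : ℝ) ^ k * D.Q n ≤ D.Q (n + k) := by exact_mod_cast D.two_pow_mul_le n k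
  calc (1 : ℝ) / D.Q (n + k) ≤ 1 / (2 ^ k * D.Q n) :=
        one_div_le_one_div_of_le (by positivity) h
    _ = _ := by rw [one_div_pow]; field_simp

theorem summable_one_div_Q (n : ℕ) : Summable fun k => (1 : ℝ) / D.Q (n + k) :=
  Summable.of_nonneg_of_le (fun k => by positivity) (D.one_div_Q_add_le n)
    (summable_geometric_two.mul_left _)

/-- The difference between the angle and `P n / Q n`. -/
noncomputable def err (n : ℕ) : ℝ := ∑' k, (1 : ℝ) / D.Q (n + 1 + k)

theorem err_eq (n : ℕ) : D.err n = 1 / D.Q (n + 1) + D.err (n + 1) := by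
  rw [err, (D.summable_one_div_Q (n + 1)).tsum_eq_zero_add, err, add_zero]
  simp only [add_assoc, add_comm 1]

theorem err_pos (n : ℕ) : 0 < D.err n := by
  have : 0 ≤ D.err (n + 1) := tsum_nonneg fun k => by positivity
  have h := D.Q_pos_real (n + 1)
  rw [err_eq]
  positivity

theorem err_le (n : ℕ) : D.err n ≤ 2 / D.Q (n + 1) := by
  have h := (D.summable_one_div_Q (n + 1)).tsum_le_tsum (D.one_div_Q_add_le (n + 1))
    (summable_geometric_two.mul_left _)
  rw [tsum_mul_left, tsum_geometric_two] at h
  rw [err]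
  linarith [show (1 : ℝ) / D.Q (n + 1) * 2 = 2 / D.Q (n + 1) by ring]

/-- The limit of `P n / Q n`. -/
noncomputable def angle : ℝ := D.P 0 / D.Q 0 + D.err 0

theorem angle_eq (n : ℕ) : D.angle = D.P n / D.Q n + D.err n := by
  induction n with
  | zero => rfl
  | succ n ih =>
    rw [ih, err_eq, D.P_succ, D.Q_succ]
    have h := D.Q_pos_real n
    have hw : (0 : ℝ) < D.w n := by exact_mod_cast D.w_pos n
    push_cast
    field_simp
    ring

theorem Q_mul_err_le (n : ℕ) : D.Q n * D.err n ≤ 2 / D.w n := by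
  have h := D.Q_pos_real n
  have hw : (0 : ℝ) < D.w n := by exact_mod_cast D.w_pos n
  calc D.Q n * D.err n ≤ D.Q n * (2 / D.Q (n + 1)) := by gcongr; exact D.err_le n
    _ = 2 / D.w n := by rw [D.Q_succ]; push_cast; field_simp

theorem le_Q (n : ℕ) : n + 2 ≤ D.Q n := by
  induction n with
  | zero => exact D.two_le_zero
  | succ n ih => have := D.two_mul_Q_le n; omega

theorem irrational_angle : Irrational D.angle := by
  rintro ⟨r, hr⟩
  set b := r.den with hb
  have hb0 : 0 < b := r.pos
  have hbR : (0 : ℝ) < b := by exact_mod_cast hb0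
  have hrat : D.angle * b = r.num := by
    rw [← hr]
    exact_mod_cast Rat.mul_den_eq_num r
  set n := 2 * b
  have hn := D.Q_pos_real n
  have hw : (0 : ℝ) < D.w n := by exact_mod_cast D.w_pos n
  have hwn : 2 * b < D.w n := by have := D.le_Q n; have := D.Q_le_w n; omega
  have hwn' : (2 : ℝ) * b < D.w n := by exact_mod_cast hwn
  have h1 : (((D.Q n : ℤ) * r.num - D.P n * b : ℤ) : ℝ) = b * (D.Q n * D.err n) := by
    push_cast
    rw [← hrat, D.angle_eq n]
    field_simp
    ring
  have h2 : 0 < (((D.Q n : ℤ) * r.num - D.P n * b : ℤ) : ℝ) := by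
    rw [h1]; have := D.err_pos n; positivity
  have h3 : (((D.Q n : ℤ) * r.num - D.P n * b : ℤ) : ℝ) < 1 := by
    rw [h1]
    calc b * (D.Q n * D.err n) ≤ b * (2 / D.w n) := by gcongr; exact D.Q_mul_err_le n
      _ < 1 := by rw [mul_div_assoc', div_lt_one hw]; linarith
  have h2' : 0 < (D.Q n : ℤ) * r.num - D.P n * b := by exact_mod_cast h2
  have h3' : (D.Q n : ℤ) * r.num - D.P n * b < 1 := by exact_mod_cast h3
  omega

/-! #### Positions on the circle -/

/-- The representative in `[0, 1)` of a point of the circle. -/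
noncomputable def rep (x : AddCircle (1 : ℝ)) : ℝ := AddCircle.equivIco 1 0 x

theorem rep_nonneg (x : AddCircle (1 : ℝ)) : 0 ≤ rep x := (AddCircle.equivIco 1 0 x).2.1

theorem rep_lt_one (x : AddCircle (1 : ℝ)) : rep x < 1 :=
  (AddCircle.equivIco 1 0 x).2.2.trans_eq (zero_add 1)

theorem coe_rep (x : AddCircle (1 : ℝ)) : ((rep x : ℝ) : AddCircle (1 : ℝ)) = x :=
  (AddCircle.equivIco 1 0).symm_apply_apply x

theorem rep_coe (t : ℝ) : rep (t : AddCircle (1 : ℝ)) = Int.fract t := by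
  have h := AddCircle.coe_equivIco_mk_apply (1 : ℝ) t
  rwa [div_one, mul_one] at h

theorem measurable_rep : Measurable rep :=
  measurable_subtype_coe.comp (AddCircle.measurableEquivIco (1 : ℝ) 0).measurable

/-- The index of the interval of length `1 / Q n` containing a point. -/
noncomputable def pos (n : ℕ) (x : AddCircle (1 : ℝ)) : ℕ := ⌊D.Q n * rep x⌋₊

theorem measurable_pos (n : ℕ) : Measurable (D.pos n) :=
  Nat.measurable_floor.comp (measurable_rep.const_mul _)

theorem pos_lt (n : ℕ) (x : AddCircle (1 : ℝ)) : D.pos n x < D.Q n := by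
  have hn := D.Q_pos_real n
  have := rep_lt_one x
  have := rep_nonneg x
  rw [pos, Nat.floor_lt (by positivity)]
  nlinarith

theorem pos_eq_div (n : ℕ) (x : AddCircle (1 : ℝ)) : D.pos n x = D.pos (n + 1) x / D.w n := by
  have hw : (0 : ℝ) < D.w n := by exact_mod_cast D.w_pos n
  rw [pos, pos, ← Nat.floor_div_natCast, D.Q_succ]
  congr 1
  push_cast
  field_simp

theorem natCast_pos_le (n : ℕ) (x : AddCircle (1 : ℝ)) : (D.pos n x : ℝ) ≤ D.Q n * rep x :=
  Nat.floor_le (mul_nonneg (Nat.cast_nonneg _) (rep_nonneg x))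

theorem lt_natCast_pos_add_one (n : ℕ) (x : AddCircle (1 : ℝ)) :
    D.Q n * rep x < (D.pos n x : ℝ) + 1 :=
  Nat.lt_floor_add_one _

theorem eq_of_forall_pos_eq {x y : AddCircle (1 : ℝ)} (h : ∀ n, D.pos n x = D.pos n y) :
    x = y := by
  rw [← coe_rep x, ← coe_rep y]
  congr 1
  by_contra hne
  have hpos : 0 < |rep x - rep y| := abs_pos.2 (sub_ne_zero.2 hne)
  obtain ⟨n, hn⟩ := exists_nat_gt (1 / |rep x - rep y|)
  have hQ := D.Q_pos_real n
  have h1 : (n : ℝ) < D.Q n := by have := D.le_Q n; exact_mod_cast (by omega : n < D.Q n)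
  have h2 : |D.Q n * rep x - D.Q n * rep y| < 1 := by
    have a1 := D.natCast_pos_le n x
    have a2 := D.natCast_pos_le n y
    have a3 := D.lt_natCast_pos_add_one n x
    have a4 := D.lt_natCast_pos_add_one n y
    rw [h n] at a1 a3
    rw [abs_lt]
    constructor <;> linarith
  rw [← mul_sub, abs_mul, abs_of_pos hQ] at h2
  rw [div_lt_iff₀ hpos] at hn
  nlinarith

theorem pos_add_zsmul {n : ℕ} {x : AddCircle (1 : ℝ)} {m : ℤ} (hm : |m| ≤ 2 * D.Q n)
    (h1 : 4 * D.Q n ≤ D.pos (n + 1) x % D.w n)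
    (h2 : D.pos (n + 1) x % D.w n + 4 * D.Q n < D.w n) :
    (D.pos n (x + m • (D.angle : AddCircle (1 : ℝ))) : ℤ)
      ≡ D.pos n x + m * D.P n [ZMOD D.Q n] := by
  have hQ := D.Q_pos_real n
  have hw : (0 : ℝ) < D.w n := by exact_mod_cast D.w_pos n
  set δ : ℝ := D.Q n * D.err n * m with hδ
  have hδ' : |δ| ≤ 4 * D.Q n / D.w n := by
    have := D.err_pos n
    rw [hδ, abs_mul, abs_of_pos (by positivity)]
    have hm' : |(m : ℝ)| ≤ 2 * D.Q n := by exact_mod_cast hm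
    calc _ ≤ (2 / D.w n : ℝ) * (2 * D.Q n) := by gcongr; exact D.Q_mul_err_le n
      _ = _ := by ring
  set j := D.pos n x with hj
  set u := D.pos (n + 1) x % D.w n with hu
  have hsplit : D.pos (n + 1) x = D.w n * j + u := by
    rw [hj, D.pos_eq_div n, hu, Nat.div_add_mod]
  have b1 := D.natCast_pos_le (n + 1) x
  have b2 := D.lt_natCast_pos_add_one (n + 1) x
  rw [hsplit, D.Q_succ] at b1 b2
  push_cast at b1 b2
  have hu1 : (4 : ℝ) * D.Q n ≤ u := by exact_mod_cast h1
  have hu2 : (u : ℝ) + 1 + 4 * D.Q n ≤ D.w n := by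
    exact_mod_cast (by omega : u + 1 + 4 * D.Q n ≤ D.w n)
  have c1 : (j : ℝ) ≤ D.Q n * rep x + δ := by
    have : 4 * D.Q n / D.w n ≤ D.Q n * rep x - j := by
      rw [div_le_iff₀ hw]; linarith
    linarith [(abs_le.1 hδ').1]
  have c2 : D.Q n * rep x + δ < j + 1 := by
    have : 4 * D.Q n / D.w n < j + 1 - D.Q n * rep x := by
      rw [div_lt_iff₀ hw]; linarith
    linarith [(abs_le.1 hδ').2]
  have hx : x + m • (D.angle : AddCircle (1 : ℝ)) = ((rep x + m * D.angle : ℝ) : AddCircle _) := by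
    conv_lhs => rw [← coe_rep x]
    rw [← AddCircle.coe_zsmul, ← AddCircle.coe_add, zsmul_eq_mul]
  set F := ⌊rep x + m * D.angle⌋ with hF
  have hpos : (D.pos n (x + m • (D.angle : AddCircle (1 : ℝ))) : ℤ)
      = j + m * D.P n - D.Q n * F := by
    rw [pos, Int.natCast_floor_eq_floor (mul_nonneg hQ.le (rep_nonneg _)), hx, rep_coe,
      Int.floor_eq_iff, Int.fract, ← hF]
    have e : (D.Q n : ℝ) * (rep x + m * D.angle - F)
        = (D.Q n * rep x + δ) + m * D.P n - D.Q n * F := by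
      rw [D.angle_eq n, hδ]
      field_simp
      ring
    rw [e]
    push_cast
    constructor <;> linarith
  rw [hpos]
  exact Int.modEq_iff_dvd.2 ⟨F, by ring⟩

theorem zIter_rot (θ : ℝ) (m : ℤ) (x : AddCircle (1 : ℝ)) :
    zIter (rot θ) m x = x + m • (θ : AddCircle (1 : ℝ)) := by
  have hn : ∀ (t : AddCircle (1 : ℝ)) (k : ℕ), (fun y => t + y)^[k] x = x + k • t := by
    intro t k
    induction k with
    | zero => simp
    | succ k ih => rw [Function.iterate_succ_apply', ih, succ_nsmul]; abel
  rw [zIter]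
  split_ifs with h
  · obtain ⟨k, rfl⟩ := Int.eq_ofNat_of_zero_le h
    have : (⇑(rot θ)) = fun y => (θ : AddCircle (1 : ℝ)) + y := rfl
    rw [this, hn]
    simp
  · obtain ⟨k, hk⟩ := Int.eq_ofNat_of_zero_le (by omega : 0 ≤ -m)
    obtain rfl : m = -(k : ℤ) := by omega
    have : (⇑(rot θ).symm) = fun y => -(θ : AddCircle (1 : ℝ)) + y := rfl
    rw [this, hn]
    simp

/-! #### The odometer and the rotation -/

/-- The cutting parameters of the odometer. -/
def cs : ℕ → CSParam
  | 0 => ⟨D.Q 0, D.two_le_Q 0, fun _ => 0, fun _ _ => rfl⟩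
  | n + 1 => ⟨D.w n, D.two_le_w n, fun _ => 0, fun _ _ => rfl⟩

theorem cs_σ (n i : ℕ) : (D.cs n).σ i = 0 := by cases n <;> rfl

theorem heights_cs_succ (n : ℕ) : heights D.cs (n + 1) = D.Q n := by
  induction n with
  | zero => rw [heights_eq_prod D.cs_σ]; simp [cs]
  | succ n ih =>
    rw [heights_eq_prod D.cs_σ, Finset.prod_range_succ, ← heights_eq_prod D.cs_σ, ih, D.Q_succ]
    rfl

theorem exists_dvd_prod_cs (N : ℕ) (hN : 0 < N) :
    ∃ n, N ∣ ∏ k ∈ Finset.range n, (D.cs k).q := by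
  simp_rw [← heights_eq_prod D.cs_σ]
  rcases N with _ | _ | N
  · omega
  · exact ⟨0, one_dvd _⟩
  · refine ⟨N + 2, ?_⟩
    rw [heights_cs_succ, D.Q_succ']
    exact ((D.dvd_s N).mul_left _).mul_left _

/-- The level functions of the odometer on the circle. -/
noncomputable def lev : ℕ → AddCircle (1 : ℝ) → ℕ
  | 0, _ => 0
  | n + 1, x => D.sl n (D.pos n x)

theorem measurable_lev (n : ℕ) : Measurable (D.lev n) := by
  cases n with
  | zero => exact measurable_const
  | succ n => exact (Measurable.of_discrete (f := D.sl n)).comp (D.measurable_pos n)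

theorem lev_lt (n : ℕ) (x : AddCircle (1 : ℝ)) : D.lev n x < heights D.cs n := by
  cases n with
  | zero => exact one_pos
  | succ n => rw [heights_cs_succ]; exact D.sl_lt (D.pos_lt n x)

theorem sl_pos_mod (n : ℕ) (x : AddCircle (1 : ℝ)) :
    D.sl (n + 1) (D.pos (n + 1) x) % D.Q n = D.sl n (D.pos n x) := by
  rw [D.sl_mod (D.pos_lt _ _), ← D.pos_eq_div]

theorem lev_mod (n : ℕ) (x : AddCircle (1 : ℝ)) :
    D.lev (n + 1) x % heights D.cs n = D.lev n x := by
  cases n with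
  | zero => exact Nat.mod_one _
  | succ n => rw [heights_cs_succ]; exact D.sl_pos_mod n x

theorem lev_sep (x y : AddCircle (1 : ℝ)) (h : ∀ n, D.lev n x = D.lev n y) : x = y :=
  D.eq_of_forall_pos_eq fun n => D.sl_inj (D.pos_lt n x) (D.pos_lt n y) (h (n + 1))

theorem sl_pos_modEq {k l : ℕ} (hkl : k ≤ l) (x : AddCircle (1 : ℝ)) :
    D.sl l (D.pos l x) ≡ D.sl k (D.pos k x) [MOD D.Q k] := by
  induction l, hkl using Nat.le_induction with
  | base => rfl
  | succ l hkl ih =>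
    refine Nat.ModEq.trans ?_ ih
    have h : D.sl (l + 1) (D.pos (l + 1) x) ≡ D.sl l (D.pos l x) [MOD D.Q l] := by
      rw [← D.sl_pos_mod l x]
      exact (Nat.mod_modEq _ _).symm
    refine h.of_dvd ?_
    obtain ⟨i, rfl⟩ := Nat.exists_eq_add_of_le hkl
    clear ih h hkl
    induction i with
    | zero => exact dvd_rfl
    | succ i ih => exact ih.trans (by rw [← add_assoc, D.Q_succ]; exact dvd_mul_right _ _)

/-- The points which are in good position at all scales from `N` on. -/
def goodSet (N : ℕ) : Set (AddCircle (1 : ℝ)) := {x | ∀ k ≥ N, D.Good k (D.pos (k + 1) x)}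

theorem measurableSet_bad (k : ℕ) :
    MeasurableSet {x | ¬ D.Good k (D.pos (k + 1) x)} :=
  D.measurable_pos (k + 1) (MeasurableSet.of_discrete (s := {j | ¬ D.Good k j}))

theorem compl_goodSet (N : ℕ) :
    (D.goodSet N)ᶜ = ⋃ i, {x | ¬ D.Good (N + i) (D.pos (N + i + 1) x)} := by
  ext x
  simp only [goodSet, mem_compl_iff, mem_ofPred_eq, mem_iUnion, not_forall]
  constructor
  · rintro ⟨k, hk, h⟩
    obtain ⟨i, rfl⟩ := Nat.exists_eq_add_of_le hk
    exact ⟨i, h⟩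
  · rintro ⟨i, h⟩
    exact ⟨N + i, Nat.le_add_right _ _, h⟩

theorem measurableSet_goodSet (N : ℕ) : MeasurableSet (D.goodSet N) := by
  rw [← compl_compl (D.goodSet N), compl_goodSet]
  exact (MeasurableSet.iUnion fun i => D.measurableSet_bad _).compl

section Shift

variable {D} {N : ℕ} {x : AddCircle (1 : ℝ)} {m ε : ℤ}

theorem pos_zIter_modEq (hx : x ∈ D.goodSet N) (hm : |m| ≤ 2 * D.Q N) {k : ℕ} (hk : N ≤ k) :
    (D.pos k (zIter (rot D.angle) m x) : ℤ) ≡ D.pos k x + m * D.P k [ZMOD D.Q k] := by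
  obtain ⟨⟨h1, h2⟩, -⟩ := hx k hk
  have : D.Q N ≤ D.Q k := D.Q_mono hk
  rw [zIter_rot]
  exact D.pos_add_zsmul (by omega) h1 h2

theorem levShift_of_tl_eq (hx : x ∈ D.goodSet N) (hm : |m| ≤ 2 * D.Q N) (hε : |ε| ≤ 1)
    (htl : (D.tl N (D.pos N (zIter (rot D.angle) m x)) : ℤ)
      = D.tl N (D.pos N x) + m - ε * D.Q N) :
    LevShift (heights D.cs) D.lev
      (D.sl N (D.pos N (zIter (rot D.angle) m x)) - D.sl N (D.pos N x) + ε * D.Q N)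
      x (zIter (rot D.angle) m x) := by
  set y := zIter (rot D.angle) m x
  have key : ∀ k, N + 1 ≤ k → _ := fun k hk =>
    D.sl_shift (J := fun k => D.pos k x) (J' := fun k => D.pos k y)
      (fun n => D.pos_eq_div n x) (fun n => D.pos_eq_div n y) hx hm hε
      (fun k hk => pos_zIter_modEq hx hm hk) htl hk
  rintro (_ | k)
  · exact Int.modEq_one
  · rw [heights_cs_succ]
    have h1 := Int.natCast_modEq_iff.2 (D.sl_pos_modEq (le_max_left k (N + 1)) x)
    have h2 := Int.natCast_modEq_iff.2 (D.sl_pos_modEq (le_max_left k (N + 1)) y)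
    have h3 := key _ (le_max_right k (N + 1))
    refine h2.symm.trans ?_
    rw [← h3]
    refine Int.ModEq.trans ?_ (h1.add_right _)
    rw [add_sub_cancel]

theorem levShift_target (hx : x ∈ D.goodSet N) (hε : |ε| ≤ 1) {j : ℕ} (hj : j < D.Q N) :
    ∃ m : ℤ, |m| ≤ 2 * D.Q N ∧ LevShift (heights D.cs) D.lev
      (D.sl N j - D.sl N (D.pos N x) + ε * D.Q N) x (zIter (rot D.angle) m x) := by
  have h1 := D.tl_lt N j
  have h2 := D.tl_lt N (D.pos N x)
  have hε' : ε = -1 ∨ ε = 0 ∨ ε = 1 := by have := abs_le.1 hε; omega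
  refine ⟨D.tl N j - D.tl N (D.pos N x) + ε * D.Q N, ?_, ?_⟩
  · rcases hε' with rfl | rfl | rfl <;> rw [abs_le] <;> constructor <;> omega
  · set m : ℤ := D.tl N j - D.tl N (D.pos N x) + ε * D.Q N with hm
    have hmle : |m| ≤ 2 * D.Q N := by
      rcases hε' with rfl | rfl | rfl <;> rw [abs_le] <;> constructor <;> omega
    have h3 : D.tl N (D.pos N (zIter (rot D.angle) m x)) = D.tl N j := by
      have h4 := D.tl_shift (pos_zIter_modEq hx hmle le_rfl)
      have h5 : (D.tl N (D.pos N x) : ℤ) + m ≡ D.tl N j [ZMOD D.Q N] :=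
        Int.modEq_iff_dvd.2 ⟨-ε, by rw [hm]; ring⟩
      exact Nat.ModEq.eq_of_lt_of_lt (Int.natCast_modEq_iff.1 (h4.trans h5)) (D.tl_lt _ _) h1
    have h6 := levShift_of_tl_eq hx hmle hε (by rw [h3, hm]; ring)
    rwa [D.tl_inj (D.pos_lt _ _) hj h3] at h6

theorem exists_levShift_one (hx : x ∈ D.goodSet N) :
    ∃ m : ℤ, |m| ≤ (2 * D.Q N : ℕ) ∧
      LevShift (heights D.cs) D.lev 1 x (zIter (rot D.angle) m x) := by
  have hQ := D.Q_pos N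
  have hB := D.sl_lt (D.pos_lt N x)
  push_cast
  by_cases h : D.sl N (D.pos N x) + 1 < D.Q N
  · obtain ⟨j, hj, hjB⟩ := D.exists_sl_eq h
    obtain ⟨m, hm, hs⟩ := levShift_target (ε := 0) hx (by simp) hj
    refine ⟨m, hm, ?_⟩
    rwa [hjB, show ((D.sl N (D.pos N x) + 1 : ℕ) : ℤ) - D.sl N (D.pos N x) + 0 * D.Q N = 1 by
      push_cast; ring] at hs
  · obtain ⟨j, hj, hjB⟩ := D.exists_sl_eq hQ
    obtain ⟨m, hm, hs⟩ := levShift_target (ε := 1) hx (by simp) hj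
    refine ⟨m, hm, ?_⟩
    rwa [hjB, show ((0 : ℕ) : ℤ) - D.sl N (D.pos N x) + 1 * D.Q N = 1 by omega] at hs

theorem exists_levShift_neg_one (hx : x ∈ D.goodSet N) :
    ∃ m : ℤ, LevShift (heights D.cs) D.lev (-1) x (zIter (rot D.angle) m x) := by
  have hQ := D.Q_pos N
  have hB := D.sl_lt (D.pos_lt N x)
  by_cases h : D.sl N (D.pos N x) = 0
  · obtain ⟨j, hj, hjB⟩ := D.exists_sl_eq (Nat.sub_lt hQ one_pos)
    obtain ⟨m, -, hs⟩ := levShift_target (ε := -1) hx (by simp) hj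
    refine ⟨m, ?_⟩
    rwa [hjB, h, show ((D.Q N - 1 : ℕ) : ℤ) - (0 : ℕ) + -1 * D.Q N = -1 by omega] at hs
  · obtain ⟨j, hj, hjB⟩ := D.exists_sl_eq ((Nat.sub_le _ 1).trans_lt hB)
    obtain ⟨m, -, hs⟩ := levShift_target (ε := 0) hx (by simp) hj
    refine ⟨m, ?_⟩
    rwa [hjB, show ((D.sl N (D.pos N x) - 1 : ℕ) : ℤ) - D.sl N (D.pos N x) + 0 * D.Q N = -1 by
      omega] at hs

theorem exists_levShift_rot (hx : x ∈ D.goodSet N) :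
    ∃ m : ℤ, |m| ≤ (2 * D.Q N : ℕ) ∧ LevShift (heights D.cs) D.lev m x (rot D.angle x) := by
  have hQ := D.two_le_Q N
  have h1 : |(1 : ℤ)| ≤ 2 * D.Q N := by rw [abs_one]; omega
  have h2 := D.tl_shift (pos_zIter_modEq hx h1 le_rfl)
  have h3 := D.tl_lt N (D.pos N x)
  have h4 := D.tl_lt N (D.pos N (zIter (rot D.angle) 1 x))
  have h5 := D.sl_lt (D.pos_lt N x)
  have h6 := D.sl_lt (D.pos_lt N (zIter (rot D.angle) 1 x))
  rw [← zIter_one (rot D.angle) x]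
  push_cast
  by_cases h : D.tl N (D.pos N x) + 1 < D.Q N
  · have h7 := eq_of_modEq_of_bounds h2 (by omega) (by omega) (by omega) (by omega)
    refine ⟨_, ?_, levShift_of_tl_eq (ε := 0) hx h1 (by simp) (by rw [h7]; ring)⟩
    rw [abs_le]; constructor <;> omega
  · have h7 : (D.tl N (D.pos N (zIter (rot D.angle) 1 x)) : ℤ)
        = D.tl N (D.pos N x) + 1 - D.Q N :=
      eq_of_modEq_of_bounds (h2.trans (Int.modEq_iff_dvd.2 ⟨-1, by ring⟩)) (by omega) (by omega)
        (by omega) (by omega)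
    refine ⟨_, ?_, levShift_of_tl_eq (ε := 1) hx h1 (by simp) (by rw [h7]; ring)⟩
    rw [abs_le]; constructor <;> omega

end Shift

end RotData

theorem SmallOCbrt.exists_le {φ : ℝ → ℝ} (hφ0 : ∀ t : ℝ, 0 ≤ t → 0 ≤ φ t) (hφ : SmallOCbrt φ) :
    ∃ C : ℝ, 0 ≤ C ∧ ∀ r t : ℕ, 1 ≤ r → t ≤ r ^ 3 → φ t ≤ C * r := by
  obtain ⟨T, hT⟩ := eventually_atTop.1 (hφ.eventually (gt_mem_nhds one_pos))
  set M := ⌈max T 1⌉₊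
  have hsum : ∀ s : Finset ℕ, 0 ≤ ∑ t ∈ s, φ t := fun s =>
    Finset.sum_nonneg fun t _ => hφ0 t (Nat.cast_nonneg t)
  refine ⟨1 + ∑ t ∈ Finset.range M, φ t, add_nonneg zero_le_one (hsum _), fun r t hr ht => ?_⟩
  have hr' : (1 : ℝ) ≤ r := by exact_mod_cast hr
  by_cases h : t < M
  · have h1 : φ t ≤ ∑ t ∈ Finset.range M, φ t :=
      Finset.single_le_sum (f := fun t : ℕ => φ t) (fun t _ => hφ0 t (Nat.cast_nonneg t))
        (Finset.mem_range.2 h)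
    nlinarith [hsum (Finset.range M)]
  · have hmax : max T 1 ≤ (t : ℝ) := Nat.ceil_le.1 (not_lt.1 h)
    have ht1 : (0 : ℝ) < t := zero_lt_one.trans_le ((le_max_right _ _).trans hmax)
    have h1 := hT t ((le_max_left _ _).trans hmax)
    rw [div_lt_one (Real.rpow_pos_of_pos ht1 _)] at h1
    have h2 : (t : ℝ) ^ ((1 : ℝ) / 3) ≤ r := by
      calc (t : ℝ) ^ ((1 : ℝ) / 3) ≤ ((r : ℝ) ^ 3) ^ ((1 : ℝ) / 3) :=
            Real.rpow_le_rpow ht1.le (by exact_mod_cast ht) (by norm_num)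
        _ = r := by
            rw [← Real.rpow_natCast, ← Real.rpow_mul (by positivity)]; norm_num
    nlinarith [hsum (Finset.range M)]

namespace RotData

variable (D : RotData)

/-! #### Measure of the bad positions -/

theorem volume_pos_eq_le (n j : ℕ) :
    volume {x | D.pos n x = j} ≤ ENNReal.ofReal (1 / D.Q n) := by
  have hQ := D.Q_pos_real n
  rw [AddCircle.add_projection_respects_measure 1 0 (U := {x | D.pos n x = j})
    (D.measurable_pos n (measurableSet_singleton j))]
  have hsub : QuotientAddGroup.mk ⁻¹' {x : AddCircle (1 : ℝ) | D.pos n x = j} ∩ Ioc (0 : ℝ) (0 + 1)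
      ⊆ Icc ((j : ℝ) / D.Q n) ((j + 1) / D.Q n) ∪ {1} := by
    rintro t ⟨ht, ht0, ht1⟩
    rw [zero_add] at ht1
    rcases ht1.lt_or_eq with h | h
    · left
      have hrep : rep (t : AddCircle (1 : ℝ)) = t := by
        rw [rep_coe, Int.fract_eq_self.2 ⟨ht0.le, h⟩]
      have hj : D.pos n (t : AddCircle (1 : ℝ)) = j := ht
      have h1 := D.natCast_pos_le n (t : AddCircle (1 : ℝ))
      have h2 := D.lt_natCast_pos_add_one n (t : AddCircle (1 : ℝ))
      rw [hj, hrep] at h1 h2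
      rw [mem_Icc, div_le_iff₀ hQ, le_div_iff₀ hQ]
      constructor <;> linarith
    · exact Or.inr h
  refine (measure_mono hsub).trans ((measure_union_le _ _).trans ?_)
  rw [Real.volume_Icc, Real.volume_singleton, add_zero]
  refine ENNReal.ofReal_le_ofReal (le_of_eq ?_)
  ring

open Classical in
theorem card_bad_le (k : ℕ) :
    ((Finset.range (D.Q (k + 1))).filter fun j => ¬ D.Good k j).card ≤ 12 * D.Q k ^ 2 := by
  have hQ := D.Q_pos k
  set q := D.Q k with hq
  set A := (Finset.range (D.Q (k + 1))).filter fun j =>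
    j % D.w k ∈ Finset.range (4 * q) ∪ Finset.Ico (D.w k - 4 * q) (D.w k)
  set B := (Finset.range (D.Q (k + 1))).filter fun j =>
    D.tl (k + 1) j ∈ Finset.range (2 * q) ∪ Finset.Ico (D.Q (k + 1) - 2 * q) (D.Q (k + 1))
  have hsub : ((Finset.range (D.Q (k + 1))).filter fun j => ¬ D.Good k j) ⊆ A ∪ B := by
    intro j hj
    obtain ⟨hj, hbad⟩ := Finset.mem_filter.1 hj
    rw [Good] at hbad
    simp only [A, B, Finset.mem_union, Finset.mem_filter, Finset.mem_range, Finset.mem_Ico] at hj ⊢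
    have := Nat.mod_lt j (D.w_pos k)
    have := D.tl_lt (k + 1) j
    omega
  have hcard : ∀ a b : ℕ, (Finset.range a ∪ Finset.Ico (b - a) b).card ≤ 2 * a := fun a b => by
    refine (Finset.card_union_le _ _).trans ?_
    rw [Finset.card_range, Nat.card_Ico]
    omega
  have hA : A.card ≤ q * (2 * (4 * q)) := by
    calc A.card ≤ (Finset.range q ×ˢ
          (Finset.range (4 * q) ∪ Finset.Ico (D.w k - 4 * q) (D.w k))).card := by
          refine Finset.card_le_card_of_injOn (fun j => (j / D.w k, j % D.w k)) ?_ ?_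
          · intro j hj
            have hj' := Finset.mem_filter.1 hj
            exact Finset.mem_product.2
              ⟨Finset.mem_range.2 (D.div_lt (Finset.mem_range.1 hj'.1)), hj'.2⟩
          · intro j _ j' _ h
            rw [Prod.mk.injEq] at h
            rw [← Nat.div_add_mod j (D.w k), h.1, h.2, Nat.div_add_mod]
      _ ≤ _ := by
          rw [Finset.card_product, Finset.card_range]
          exact Nat.mul_le_mul_left _ (hcard _ _)
  have hB : B.card ≤ 2 * (2 * q) := by
    refine le_trans (Finset.card_le_card_of_injOn (D.tl (k + 1)) ?_ ?_) (hcard _ (D.Q (k + 1)))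
    · exact fun j hj => (Finset.mem_filter.1 hj).2
    · intro j hj j' hj' h
      exact D.tl_inj (Finset.mem_range.1 (Finset.mem_filter.1 hj).1)
        (Finset.mem_range.1 (Finset.mem_filter.1 hj').1) h
  have := (Finset.card_le_card hsub).trans (Finset.card_union_le A B)
  nlinarith

theorem volume_bad_le (k : ℕ) :
    volume {x | ¬ D.Good k (D.pos (k + 1) x)} ≤ ENNReal.ofReal (12 / (D.Q k : ℝ) ^ 4) := by
  classical
  have hQ := D.Q_pos_real k
  set F := (Finset.range (D.Q (k + 1))).filter fun j => ¬ D.Good k j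
  have hsub : {x | ¬ D.Good k (D.pos (k + 1) x)} ⊆ ⋃ j ∈ F, {x | D.pos (k + 1) x = j} := by
    intro x hx
    exact mem_iUnion₂.2 ⟨_, Finset.mem_filter.2 ⟨Finset.mem_range.2 (D.pos_lt _ x), hx⟩, rfl⟩
  calc _ ≤ ∑ j ∈ F, volume {x | D.pos (k + 1) x = j} :=
        (measure_mono hsub).trans (measure_biUnion_finset_le _ _)
    _ ≤ ∑ j ∈ F, ENNReal.ofReal (1 / D.Q (k + 1)) :=
        Finset.sum_le_sum fun j _ => D.volume_pos_eq_le _ j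
    _ = ENNReal.ofReal (F.card * (1 / D.Q (k + 1))) := by
        rw [Finset.sum_const, ← ENNReal.ofReal_nsmul, nsmul_eq_mul]
    _ ≤ _ := by
        refine ENNReal.ofReal_le_ofReal ?_
        have h1 : (F.card : ℝ) ≤ 12 * (D.Q k : ℝ) ^ 2 := by exact_mod_cast D.card_bad_le k
        have h2 : (D.Q k : ℝ) ^ 6 ≤ D.Q (k + 1) := by
          have := Nat.le_mul_of_pos_right (D.Q k * D.Q k ^ 5) (D.s_pos k)
          rw [D.Q_succ', ← mul_assoc]
          calc (D.Q k : ℝ) ^ 6 = ((D.Q k * D.Q k ^ 5 : ℕ) : ℝ) := by push_cast; ring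
            _ ≤ _ := by exact_mod_cast this
        calc (F.card : ℝ) * (1 / D.Q (k + 1)) ≤ 12 * (D.Q k : ℝ) ^ 2 * (1 / (D.Q k : ℝ) ^ 6) := by
              gcongr
          _ = _ := by field_simp

theorem volume_compl_goodSet_le (N : ℕ) :
    volume (D.goodSet N)ᶜ ≤ ENNReal.ofReal (24 / (D.Q N : ℝ) ^ 4) := by
  have hQ := D.Q_pos_real N
  rw [compl_goodSet]
  calc _ ≤ ∑' i, ENNReal.ofReal (12 / (D.Q N : ℝ) ^ 4 * (1 / 2) ^ i) := by
        refine (measure_iUnion_le _).trans (ENNReal.tsum_le_tsum fun i => ?_)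
        refine (D.volume_bad_le (N + i)).trans (ENNReal.ofReal_le_ofReal ?_)
        have h1 : (2 : ℝ) ^ i * D.Q N ≤ D.Q (N + i) := by exact_mod_cast D.two_pow_mul_le N i
        have h2 : (2 : ℝ) ^ i * (D.Q N : ℝ) ^ 4 ≤ (D.Q (N + i) : ℝ) ^ 4 := by
          have h3 : (1 : ℝ) ≤ 2 ^ i := one_le_pow₀ one_le_two
          calc (2 : ℝ) ^ i * (D.Q N : ℝ) ^ 4 ≤ ((2 : ℝ) ^ i) ^ 4 * (D.Q N : ℝ) ^ 4 := by
                gcongr; exact le_self_pow₀ h3 (by norm_num)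
            _ = ((2 : ℝ) ^ i * D.Q N) ^ 4 := by ring
            _ ≤ _ := by gcongr
        calc (12 : ℝ) / (D.Q (N + i) : ℝ) ^ 4 ≤ 12 / (2 ^ i * (D.Q N : ℝ) ^ 4) := by gcongr
          _ = _ := by rw [one_div_pow]; field_simp
    _ = ENNReal.ofReal (∑' i, 12 / (D.Q N : ℝ) ^ 4 * (1 / 2) ^ i) :=
        (ENNReal.ofReal_tsum_of_nonneg (fun i => by positivity)
          (summable_geometric_two.mul_left _)).symm
    _ = _ := by rw [tsum_mul_left, tsum_geometric_two]; ring_nf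

theorem tsum_mul_volume_ne_top {C : ℝ} (hC : 0 ≤ C) :
    ∑' N, ENNReal.ofReal (C * (D.Q N : ℝ) ^ 3) * volume (D.goodSet N)ᶜ ≠ ⊤ := by
  have hs : Summable fun N => 24 * C * (1 / (D.Q N : ℝ)) := by
    simpa using (D.summable_one_div_Q 0).mul_left (24 * C)
  have h : ∀ N, ENNReal.ofReal (C * (D.Q N : ℝ) ^ 3) * volume (D.goodSet N)ᶜ
      ≤ ENNReal.ofReal (24 * C * (1 / (D.Q N : ℝ))) := fun N => by
    have hQ := D.Q_pos_real N
    calc _ ≤ ENNReal.ofReal (C * (D.Q N : ℝ) ^ 3) * ENNReal.ofReal (24 / (D.Q N : ℝ) ^ 4) := by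
          gcongr; exact D.volume_compl_goodSet_le N
      _ = _ := by
          rw [← ENNReal.ofReal_mul (by positivity)]
          congr 1
          field_simp
  refine ne_top_of_le_ne_top ?_ (ENNReal.tsum_le_tsum h)
  rw [← ENNReal.ofReal_tsum_of_nonneg (fun N => by positivity) hs]
  exact ENNReal.ofReal_ne_top

theorem ae_exists_mem_goodSet : ∀ᵐ x, ∃ N, x ∈ D.goodSet N := by
  have h : ∑' N, volume (D.goodSet N)ᶜ ≠ ⊤ := by
    refine ne_top_of_le_ne_top (D.tsum_mul_volume_ne_top zero_le_one)
      (ENNReal.tsum_le_tsum fun N => le_mul_of_one_le_left' ?_)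
    have : (1 : ℝ) ≤ D.Q N := by exact_mod_cast D.Q_pos N
    rw [one_mul, ENNReal.one_le_ofReal]
    exact one_le_pow₀ this
  filter_upwards [ae_eventually_notMem h] with x hx
  obtain ⟨N, hN⟩ := hx.exists
  exact ⟨N, not_notMem.1 hN⟩

theorem measurePreserving_rot (θ : ℝ) : MeasurePreserving (rot θ) volume volume :=
  measurePreserving_add_left volume (θ : AddCircle (1 : ℝ))

theorem phiOEToUnivOdometer {φ : ℝ → ℝ} (hφ0 : ∀ t : ℝ, 0 ≤ t → 0 ≤ φ t) (hφ : SmallOCbrt φ) :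
    PhiOEToUnivOdometer (volume : Measure (AddCircle (1 : ℝ))) (rot D.angle) φ := by
  obtain ⟨C, hC0, hC⟩ := hφ.exists_le hφ0
  have : IsProbabilityMeasure (volume : Measure (AddCircle (1 : ℝ))) :=
    ⟨by rw [AddCircle.measure_univ, ENNReal.ofReal_one]⟩
  have : NullSingletonClass (volume : Measure (AddCircle (1 : ℝ))) :=
    ⟨fun x => by rw [← Metric.closedBall_zero, AddCircle.volume_closedBall]; simp⟩
  refine phiOEToUnivOdometer_of_levels (measurePreserving_rot _) hφ0 D.cs_σ D.exists_dvd_prod_cs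
    D.measurable_lev D.lev_lt D.lev_mod D.lev_sep D.measurableSet_goodSet
    (K := fun N => 2 * D.Q N)
    (C := fun N => N.casesOn (C * (2 * D.Q 0 : ℕ)) fun N => C * ((D.Q N ^ 3 : ℕ) : ℝ)) ?_ ?_
    D.ae_exists_mem_goodSet (fun N x => exists_levShift_one)
    (fun N x => exists_levShift_neg_one) (fun N x => exists_levShift_rot)
  · rintro (_ | N) t ht
    · exact hC _ _ (by have := D.Q_pos 0; omega) (ht.trans (Nat.le_self_pow (by norm_num) _))
    · refine hC _ _ (Nat.one_le_pow _ _ (D.Q_pos N)) (ht.trans ?_)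
      rw [D.Q_succ']
      calc 2 * (D.Q N * (D.Q N ^ 5 * D.s N)) = D.Q N ^ 6 * (2 * D.s N) := by ring
        _ ≤ D.Q N ^ 6 * D.Q N ^ 3 := Nat.mul_le_mul_left _ (D.s_le N)
        _ = _ := by ring
  · simpa using D.tsum_mul_volume_ne_top hC0

end RotData

namespace RotData

/-! #### A family of angles indexed by the Cantor space -/

theorem angle_lt_angle {D D' : RotData} {n : ℕ} (hQ : D'.Q n = D.Q n) (hP : D'.P n = D.P n)
    (hs : D'.s n = 2 * D.s n) : D'.angle < D.angle := by
  have h1 := D'.err_le n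
  have h2 := D.err_pos (n + 1)
  have h3 : (D'.Q (n + 1) : ℝ) = 2 * D.Q (n + 1) := by
    rw [D'.Q_succ', D.Q_succ', hQ, hs]; push_cast; ring
  rw [D'.angle_eq n, D.angle_eq n, hQ, hP, D.err_eq n]
  rw [h3, mul_comm (2 : ℝ), div_mul_cancel_right₀ two_ne_zero, ← one_div] at h1
  linarith

section Build

variable (M : ℕ) (t : ℤ) (f : ℕ → Bool)

/-- The factor of the cutting parameter depending on `f`. -/
def buildS (n : ℕ) : ℕ := (n + 2) * if f n then 2 else 1

/-- The denominators built from `f`. -/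
def buildQ : ℕ → ℕ
  | 0 => M ^ 2
  | n + 1 => buildQ n * (buildQ n ^ 5 * buildS f n)

/-- The numerators built from `f`. -/
def buildP : ℕ → ℤ
  | 0 => t * M + 1
  | n + 1 => buildP n * (buildQ M f n ^ 5 * buildS f n : ℕ) + 1

variable {M f}

theorem buildS_pos (n : ℕ) : 0 < buildS f n :=
  Nat.mul_pos (by omega) (by split_ifs <;> norm_num)

theorem le_buildQ (hM : 2 ≤ M) (n : ℕ) : n + 4 ≤ buildQ M f n := by
  induction n with
  | zero => exact Nat.pow_le_pow_left hM 2
  | succ n ih =>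
    have h5 : 2 ≤ buildQ M f n ^ 5 :=
      calc 2 ≤ buildQ M f n := by omega
        _ ≤ _ := Nat.le_self_pow (by norm_num) _
    have h2 : 2 * 1 ≤ buildQ M f n ^ 5 * buildS f n := Nat.mul_le_mul h5 (buildS_pos n)
    rw [buildQ]
    nlinarith

variable (f) in
/-- The approximation data built from a binary sequence. -/
def build (hM : 2 ≤ M) : RotData where
  Q := buildQ M f
  P := buildP M t f
  s := buildS f
  two_le_zero := by have := le_buildQ (f := f) hM 0; omega
  coprime_zero := by
    rw [buildP, buildQ, Nat.cast_pow]
    exact IsCoprime.pow_right ⟨1, -t, by ring⟩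
  Q_succ' _ := rfl
  P_succ' _ := rfl
  s_pos := buildS_pos
  s_le n := by
    have h1 := le_buildQ (f := f) hM n
    have h2 : buildS f n ≤ (n + 2) * 2 := Nat.mul_le_mul_left _ (by split_ifs <;> norm_num)
    have h3 : 4 * buildQ M f n ≤ buildQ M f n ^ 2 * buildQ M f n :=
      Nat.mul_le_mul_right _ (by nlinarith)
    calc 2 * buildS f n ≤ 4 * buildQ M f n := by omega
      _ ≤ _ := h3.trans_eq (pow_succ _ _).symm
  dvd_s n := dvd_mul_right _ _

theorem build_eq_of_forall_lt {g : ℕ → Bool} {n : ℕ} (h : ∀ k < n, f k = g k) :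
    buildQ M f n = buildQ M g n ∧ buildP M t f n = buildP M t g n := by
  induction n with
  | zero => exact ⟨rfl, rfl⟩
  | succ n ih =>
    obtain ⟨h1, h2⟩ := ih fun k hk => h k (by omega)
    have h3 : buildS f n = buildS g n := by rw [buildS, buildS, h n n.lt_succ_self]
    simp only [buildQ, buildP, h1, h2, h3, and_self]

theorem injective_angle_build (hM : 2 ≤ M) :
    Function.Injective fun f => (build t f hM).angle := by
  have key : ∀ f g : ℕ → Bool, ∀ n, (∀ k < n, f k = g k) → f n = false → g n = true →
      (build t g hM).angle < (build t f hM).angle := by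
    intro f g n hlt hf hg
    obtain ⟨h1, h2⟩ := build_eq_of_forall_lt t hlt
    refine angle_lt_angle (n := n) h1.symm h2.symm ?_
    simp only [build, buildS, hf, hg]
    simp [mul_comm]
  intro f g hfg
  by_contra hne
  obtain ⟨n, hn⟩ := Function.ne_iff.1 hne
  classical
  have hex : ∃ n, f n ≠ g n := ⟨n, hn⟩
  have hmin : ∀ k < Nat.find hex, f k = g k := fun k hk => not_not.1 (Nat.find_min hex hk)
  have hneq := Nat.find_spec hex
  cases hf : f (Nat.find hex)
  · exact (key f g _ hmin hf (by simpa [hf] using hneq.symm)).ne' hfg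
  · exact (key g f _ (fun k hk => (hmin k hk).symm) (by simpa [hf] using hneq.symm) hf).ne hfg

theorem angle_build_mem_Ioo {a b : ℝ} (hM : 2 ≤ M) (hab : 4 < (b - a) * M) :
    (build ⌈a * M⌉ f hM).angle ∈ Ioo a b := by
  have hM0 : (2 : ℝ) ≤ M := by exact_mod_cast hM
  set D := build ⌈a * M⌉ f hM
  have hP : (D.P 0 : ℝ) = ⌈a * M⌉ * M + 1 := by
    simp [D, build, buildP]
  have hQ : (D.Q 0 : ℝ) = M ^ 2 := by simp [D, build, buildQ]
  have h1 := Int.le_ceil (a * M)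
  have h2 := Int.ceil_lt_add_one (a * M)
  have hpos := D.err_pos 0
  have herr : D.err 0 ≤ 1 / M ^ 2 := by
    refine (D.err_le 0).trans ?_
    have h3 : (2 : ℝ) * M ^ 2 ≤ D.Q 1 := by
      rw [← hQ]; exact_mod_cast D.two_mul_Q_le 0
    calc (2 : ℝ) / D.Q 1 ≤ 2 / (2 * M ^ 2) := by gcongr
      _ = _ := by field_simp
  rw [mem_Ioo, angle, hP, hQ]
  constructor
  · have : a < (⌈a * M⌉ * M + 1) / (M : ℝ) ^ 2 := by
      rw [lt_div_iff₀ (by positivity)]; nlinarith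
    linarith
  · have : (⌈a * M⌉ * M + 1) / (M : ℝ) ^ 2 + 1 / (M : ℝ) ^ 2 < b := by
      rw [← add_div, div_lt_iff₀ (by positivity)]; nlinarith
    linarith

end Build

end RotData

/-- For every map `φ : [0,∞) → [0,∞)` with `φ(t) = o(t^{1/3})` and for
every nonempty open subset `𝒱` of `ℝ`, the set of irrational numbers `θ ∈ 𝒱` such that
the irrational rotation `R_θ` is `φ`-integrably orbit equivalent to the universal
odometer is uncountable. -/
theorem uncountable_irrational_angles_in_open_set_phi_OE_to_universal_odometer
    (φ : ℝ → ℝ) (hφ0 : ∀ t : ℝ, 0 ≤ t → 0 ≤ φ t) (hφ : SmallOCbrt φ)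
    (V : Set ℝ) (hVopen : IsOpen V) (hVne : V.Nonempty) :
    ¬ ({θ : ℝ | θ ∈ V ∧ Irrational θ ∧
      PhiOEToUnivOdometer (volume : Measure (AddCircle (1 : ℝ))) (rot θ) φ}).Countable := by
  obtain ⟨a, b, hab, hVab⟩ := hVopen.exists_Ioo_subset hVne
  obtain ⟨M, hM⟩ := exists_nat_gt (max 2 (4 / (b - a)))
  have hM2 : 2 ≤ M := by exact_mod_cast ((le_max_left _ _).trans_lt hM).le
  have hMab : 4 < (b - a) * M := by
    rw [mul_comm, ← div_lt_iff₀ (sub_pos.2 hab)]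
    exact (le_max_right _ _).trans_lt hM
  intro hcount
  have hrange : (range fun f => (RotData.build ⌈a * M⌉ f hM2).angle).Countable := by
    refine hcount.mono ?_
    rintro _ ⟨f, rfl⟩
    exact ⟨hVab (RotData.angle_build_mem_Ioo hM2 hMab), RotData.irrational_angle _,
      RotData.phiOEToUnivOdometer _ hφ0 hφ⟩
  have := hrange.to_subtype
  have hc : Countable (ℕ → Bool) :=
    (Equiv.ofInjective _ (RotData.injective_angle_build ⌈a * M⌉ hM2)).injective.countable
  refine Cardinal.aleph0_lt_continuum.not_ge ?_
  rw [← Cardinal.two_power_aleph0, ← Cardinal.mk_bool, ← Cardinal.mk_nat, Cardinal.power_def,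
    Cardinal.mk_nat]
  exact Cardinal.mk_le_aleph0_iff.2 hc
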